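/- arXiv:2411.03977 — 4 statements merged into one kernel-verified Lean document; each statement's English description precedes it below -/
import Mathlib

section
/- Let K and L be convex bodies in R^n with H^{n-1}(P_{u^⊥}(K)) = H^{n-1}(P_{u^⊥}(L)) for some unit vector u for which both projections have positive (n-1)-measure. Then for every λ ∈ [0,1], the Lebesgue measure satisfies H^n((1-λ)K + λL) ≥ (1-λ)H^n(K) + λH^n(L). (Linear refinement of Brunn–Minkowski under equal projection volumes.) -/
open MeasureTheory Set Pointwise Filter
open scoped ENNReal RealInnerProductSpace

noncomputable section

/-- Orthogonal projection onto the hyperplane `u^⊥` (for a unit vector `u`),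
applied to a set. -/
def projPerp {n : ℕ} (u : EuclideanSpace ℝ (Fin n)) (S : Set (EuclideanSpace ℝ (Fin n))) :
    Set (EuclideanSpace ℝ (Fin n)) := (fun x => x - ⟪x, u⟫ • u) '' S


lemma bm_compact {A B : Set ℝ} (hA : IsCompact A) (hB : IsCompact B) (hAn : A.Nonempty)
    (hBn : B.Nonempty) : volume A + volume B ≤ volume (A + B) := by
  have ha := hA.sSup_mem hAn
  have hb := hB.sInf_mem hBn
  set a := sSup A with ha'
  set b := sInf B with hb'
  have h1 : volume (b +ᵥ A) = volume A := measure_vadd _ _ _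
  have h2 : volume (a +ᵥ B) = volume B := measure_vadd _ _ _
  have hd : AEDisjoint volume (b +ᵥ A) (a +ᵥ B) := by
    have : (b +ᵥ A) ∩ (a +ᵥ B) ⊆ {a + b} := by
      rintro x ⟨⟨y, hy, rfl⟩, ⟨z, hz, hzx⟩⟩
      have h3 : y ≤ a := le_csSup hA.bddAbove hy
      have h4 : b ≤ z := csInf_le hB.bddBelow hz
      simp only [vadd_eq_add] at hzx ⊢
      simp only [mem_singleton_iff]
      linarith
    exact measure_mono_null this (by simp)
  rw [← h1, ← h2, ← measure_union₀ (hB.vadd a).measurableSet.nullMeasurableSet hd]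
  apply measure_mono
  rintro x (⟨y, hy, rfl⟩ | ⟨y, hy, rfl⟩)
  · exact ⟨y, hy, b, hb, by simp [add_comm]⟩
  · exact ⟨a, ha, y, hy, by simp⟩

lemma bm_meas {A B C : Set ℝ} (hA : MeasurableSet A) (hB : MeasurableSet B) (hAn : A.Nonempty)
    (hBn : B.Nonempty) (h : ∀ x ∈ A, ∀ y ∈ B, x + y ∈ C) : volume A + volume B ≤ volume C := by
  obtain ⟨a, ha⟩ := hAn
  obtain ⟨b, hb⟩ := hBn
  rw [hA.measure_eq_iSup_isCompact, hB.measure_eq_iSup_isCompact]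
  have e (S : Set ℝ) : (⨆ K, ⨆ (_ : K ⊆ S), ⨆ (_ : IsCompact K), volume K) =
      ⨆ K, ⨆ (_ : K ⊆ S ∧ IsCompact K), volume K := by
    simp only [iSup_and]
  rw [e, e]
  refine ENNReal.biSup_add_biSup_le' ⟨∅, by simp⟩ ⟨∅, by simp⟩ ?_
  rintro K ⟨hKA, hK⟩ L ⟨hLB, hL⟩
  calc volume K + volume L ≤ volume (insert a K) + volume (insert b L) := by
        gcongr <;> simp
    _ ≤ volume (insert a K + insert b L) :=
        bm_compact (hK.insert a) (hL.insert b) (by simp) (by simp)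
    _ ≤ volume C := by
        apply measure_mono
        rintro _ ⟨x, hx, y, hy, rfl⟩
        exact h x (insert_subset ha hKA hx) y (insert_subset hb hLB hy)

lemma bm_scaled {A B C : Set ℝ} {a b : ℝ} (ha : 0 < a) (hb0 : 0 < b)
    (hA : MeasurableSet A) (hB : MeasurableSet B) (hAn : A.Nonempty)
    (hBn : B.Nonempty) (h : ∀ x ∈ A, ∀ y ∈ B, a * x + b * y ∈ C) :
    ENNReal.ofReal a * volume A + ENNReal.ofReal b * volume B ≤ volume C := by
  have := bm_meas (A := a • A) (B := b • B) (C := C) (hA.const_smul₀ a) (hB.const_smul₀ b)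
    hAn.smul_set hBn.smul_set (by
      rintro _ ⟨x, hx, rfl⟩ _ ⟨y, hy, rfl⟩
      exact h x hx y hy)
  simpa [Measure.addHaar_smul, abs_of_pos ha, abs_of_pos hb0] using this

lemma vol_lt (c : ℝ≥0∞) : volume (Ioi (0:ℝ) ∩ {t | ENNReal.ofReal t < c}) = c := by
  induction c using ENNReal.recTopCoe with
  | top => simp
  | coe r =>
    have : Ioi (0:ℝ) ∩ {t | ENNReal.ofReal t < r} = Ioo 0 (r : ℝ) := by
      ext t
      simp only [mem_inter_iff, mem_Ioi, mem_ofPred_eq, mem_Ioo, and_congr_right_iff]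
      intro ht
      rw [← ENNReal.ofReal_coe_nnreal, ENNReal.ofReal_lt_ofReal_iff_of_nonneg ht.le]
    rw [this]; simp

lemma layer {α : Type*} [MeasurableSpace α] (μ : Measure α) [SFinite μ] {f : α → ℝ≥0∞}
    (hf : Measurable f) :
    ∫⁻ x, f x ∂μ = ∫⁻ t in Ioi (0:ℝ), μ {x | ENNReal.ofReal t < f x} := by
  have hm : MeasurableSet {p : α × ℝ | ENNReal.ofReal p.2 < f p.1} :=
    measurableSet_lt (by fun_prop) (by fun_prop)
  have h1 (x : α) : f x = ∫⁻ t in Ioi (0:ℝ),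
      indicator {p : α × ℝ | ENNReal.ofReal p.2 < f p.1} 1 (x, t) := by
    have : (fun t => indicator {p : α × ℝ | ENNReal.ofReal p.2 < f p.1} (1 : α × ℝ → ℝ≥0∞) (x, t)) =
      indicator {t : ℝ | ENNReal.ofReal t < f x} 1 := by
      ext t; simp [indicator]
    rw [this, lintegral_indicator_one (measurableSet_lt (by fun_prop) (by fun_prop)),
      Measure.restrict_apply (measurableSet_lt (by fun_prop) (by fun_prop)), inter_comm, vol_lt]
  have h2 (t : ℝ) : μ {x | ENNReal.ofReal t < f x} = ∫⁻ x,
      indicator {p : α × ℝ | ENNReal.ofReal p.2 < f p.1} 1 (x, t) ∂μ := by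
    have : (fun x => indicator {p : α × ℝ | ENNReal.ofReal p.2 < f p.1} (1 : α × ℝ → ℝ≥0∞) (x, t)) =
      indicator {x | ENNReal.ofReal t < f x} 1 := by
      ext t; simp [indicator]
    rw [this, lintegral_indicator_one (measurableSet_lt (by fun_prop) (by fun_prop))]
  simp_rw [h2]
  rw [← lintegral_lintegral_swap]
  · exact lintegral_congr h1
  · exact ((measurable_one.indicator hm)).aemeasurable

lemma amgm {a b : ℝ} (ha : 0 < a) (hb : 0 < b) (hab : a + b = 1) (x y : ℝ≥0∞) :
    x ^ a * y ^ b ≤ ENNReal.ofReal a * x + ENNReal.ofReal b * y := by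
  have ha' : ENNReal.ofReal a ≠ 0 := by simpa using ha
  have hb' : ENNReal.ofReal b ≠ 0 := by simpa using hb
  induction x using ENNReal.recTopCoe with
  | top => simp [ENNReal.mul_top ha']
  | coe x =>
  induction y using ENNReal.recTopCoe with
  | top => simp [ENNReal.mul_top hb']
  | coe y =>
    rw [← ENNReal.coe_rpow_of_nonneg _ ha.le, ← ENNReal.coe_rpow_of_nonneg _ hb.le]
    have := NNReal.geom_mean_le_arith_mean2_weighted a.toNNReal b.toNNReal x y (by
      rw [← Real.toNNReal_add ha.le hb.le, hab]; simp)
    rw [Real.coe_toNNReal _ ha.le, Real.coe_toNNReal _ hb.le] at this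
    unfold ENNReal.ofReal
    exact_mod_cast this

lemma pl1_norm {a b : ℝ} (ha : 0 < a) (hb : 0 < b) (hab : a + b = 1) {f g h : ℝ → ℝ≥0∞}
    (hf : Measurable f) (hg : Measurable g) (hh : Measurable h)
    (hf1 : ⨆ x, f x = 1) (hg1 : ⨆ x, g x = 1)
    (H : ∀ x y, f x ^ a * g y ^ b ≤ h (a * x + b * y)) :
    (∫⁻ x, f x) ^ a * (∫⁻ x, g x) ^ b ≤ ∫⁻ x, h x := by
  refine (amgm ha hb hab _ _).trans ?_
  rw [layer _ hf, layer _ hg, layer _ hh, ← lintegral_const_mul' _ _ (by simp),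
    ← lintegral_const_mul' _ _ (by simp), ← lintegral_add_left']
  · refine lintegral_mono fun t => ?_
    by_cases ht : ENNReal.ofReal t < 1
    · refine bm_scaled ha hb (measurableSet_lt (by fun_prop) (by fun_prop))
        (measurableSet_lt (by fun_prop) (by fun_prop)) ?_ ?_ ?_
      · rw [← hf1] at ht; exact lt_iSup_iff.1 ht
      · rw [← hg1] at ht; exact lt_iSup_iff.1 ht
      · intro x hx y hy
        refine lt_of_lt_of_le ?_ (H x y)
        calc ENNReal.ofReal t = ENNReal.ofReal t ^ a * ENNReal.ofReal t ^ b := by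
              rw [← ENNReal.rpow_add_of_nonneg _ _ ha.le hb.le, hab, ENNReal.rpow_one]
          _ < _ := ENNReal.mul_lt_mul (ENNReal.rpow_lt_rpow hx ha) (ENNReal.rpow_lt_rpow hy hb)
    · push Not at ht
      have e1 : {x | ENNReal.ofReal t < f x} = ∅ := by
        ext x; simpa using (le_iSup f x).trans (hf1.le.trans ht)
      have e2 : {x | ENNReal.ofReal t < g x} = ∅ := by
        ext x; simpa using (le_iSup g x).trans (hg1.le.trans ht)
      simp [e1, e2]
  · have : Antitone fun t : ℝ => volume {x | ENNReal.ofReal t < f x} := by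
      intro s t hst
      apply measure_mono
      intro x hx
      exact lt_of_le_of_lt (ENNReal.ofReal_le_ofReal hst) hx
    exact (this.measurable.const_mul _).aemeasurable

lemma pl1_bdd {a b : ℝ} (ha : 0 < a) (hb : 0 < b) (hab : a + b = 1) {f g h : ℝ → ℝ≥0∞}
    (hf : Measurable f) (hg : Measurable g) (hh : Measurable h)
    (hf1 : ⨆ x, f x ≠ ⊤) (hg1 : ⨆ x, g x ≠ ⊤)
    (H : ∀ x y, f x ^ a * g y ^ b ≤ h (a * x + b * y)) :
    (∫⁻ x, f x) ^ a * (∫⁻ x, g x) ^ b ≤ ∫⁻ x, h x := by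
  by_cases hf0 : ⨆ x, f x = 0
  · have : ∀ x, f x = 0 := by simpa using hf0
    simp [this, ha]
  by_cases hg0 : ⨆ x, g x = 0
  · have : ∀ x, g x = 0 := by simpa using hg0
    simp [this, hb]
  set A := ⨆ x, f x
  set B := ⨆ x, g x
  have hAa : A ^ a ≠ ⊤ := ENNReal.rpow_ne_top_of_nonneg ha.le hf1
  have hBb : B ^ b ≠ ⊤ := ENNReal.rpow_ne_top_of_nonneg hb.le hg1
  have hAa0 : A ^ a ≠ 0 := by simp [ENNReal.rpow_eq_zero_iff, hf0, hf1]
  have hBb0 : B ^ b ≠ 0 := by simp [ENNReal.rpow_eq_zero_iff, hg0, hg1]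
  have key := pl1_norm ha hb hab (f := fun x => A⁻¹ * f x) (g := fun x => B⁻¹ * g x)
    (h := fun x => (A ^ a * B ^ b)⁻¹ * h x) (by fun_prop) (by fun_prop) (by fun_prop)
    (by rw [← ENNReal.mul_iSup, ENNReal.inv_mul_cancel hf0 hf1])
    (by rw [← ENNReal.mul_iSup, ENNReal.inv_mul_cancel hg0 hg1]) (by
      intro x y
      rw [ENNReal.mul_rpow_of_nonneg _ _ ha.le, ENNReal.mul_rpow_of_nonneg _ _ hb.le,
        mul_mul_mul_comm, ENNReal.inv_rpow, ENNReal.inv_rpow,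
        ENNReal.mul_inv (.inl hAa0) (.inl hAa)]
      gcongr
      exact H x y)
  rw [lintegral_const_mul _ hf, lintegral_const_mul _ hg, lintegral_const_mul _ hh,
    ENNReal.mul_rpow_of_nonneg _ _ ha.le, ENNReal.mul_rpow_of_nonneg _ _ hb.le,
        mul_mul_mul_comm, ENNReal.inv_rpow, ENNReal.inv_rpow,
        ← ENNReal.mul_inv (.inl hAa0) (.inl hAa)] at key
  exact (ENNReal.mul_le_mul_iff_right (ENNReal.inv_ne_zero.2 (ENNReal.mul_ne_top hAa hBb))
    (ENNReal.inv_ne_top.2 (mul_ne_zero hAa0 hBb0))).1 key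

lemma trunc_tendsto {f : ℝ → ℝ≥0∞} (hf : Measurable f) :
    Tendsto (fun N : ℕ => ∫⁻ x, min (f x) N) atTop (nhds (∫⁻ x, f x)) := by
  apply lintegral_tendsto_of_tendsto_of_monotone
  · intro N; fun_prop
  · refine ae_of_all _ fun x N M hNM => ?_
    dsimp only
    gcongr
  · refine ae_of_all _ fun x => ?_
    have : Tendsto (fun N : ℕ => min (f x) N) atTop (nhds (min (f x) ⊤)) :=
      tendsto_const_nhds.min ENNReal.tendsto_nat_nhds_top
    simpa using this

lemma pl1 {a b : ℝ} (ha : 0 < a) (hb : 0 < b) (hab : a + b = 1) {f g h : ℝ → ℝ≥0∞}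
    (hf : Measurable f) (hg : Measurable g) (hh : Measurable h)
    (H : ∀ x y, f x ^ a * g y ^ b ≤ h (a * x + b * y)) :
    (∫⁻ x, f x) ^ a * (∫⁻ x, g x) ^ b ≤ ∫⁻ x, h x := by
  by_cases hf0 : ∫⁻ x, f x = 0
  · simp [hf0, ha]
  by_cases hg0 : ∫⁻ x, g x = 0
  · simp [hg0, hb]
  have h1 : (∫⁻ x, f x) ^ a ≠ 0 := by simp [ENNReal.rpow_eq_zero_iff, hf0, ha.le]
  have h2 : (∫⁻ x, g x) ^ b ≠ 0 := by simp [ENNReal.rpow_eq_zero_iff, hg0, hb.le]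
  have ht : Tendsto (fun N : ℕ => (∫⁻ x, min (f x) N) ^ a * (∫⁻ x, min (g x) N) ^ b) atTop
      (nhds ((∫⁻ x, f x) ^ a * (∫⁻ x, g x) ^ b)) :=
    ENNReal.Tendsto.mul ((trunc_tendsto hf).ennrpow_const a) (.inl h1)
      ((trunc_tendsto hg).ennrpow_const b) (.inl h2)
  refine le_of_tendsto' ht fun N => ?_
  have hs (f : ℝ → ℝ≥0∞) : ⨆ x, min (f x) N ≠ ⊤ :=
    ne_top_of_le_ne_top (ENNReal.natCast_ne_top N) (iSup_le fun x => min_le_right _ _)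
  refine pl1_bdd ha hb hab (by fun_prop) (by fun_prop) hh (hs f) (hs g) fun x y => ?_
  refine le_trans ?_ (H x y)
  gcongr <;> exact min_le_left _ _

lemma pln {a b : ℝ} (ha : 0 < a) (hb : 0 < b) (hab : a + b = 1) (d : ℕ) :
    ∀ {f g h : (Fin d → ℝ) → ℝ≥0∞},
    Measurable f → Measurable g → Measurable h →
    (∀ x y, f x ^ a * g y ^ b ≤ h (a • x + b • y)) →
    (∫⁻ x, f x) ^ a * (∫⁻ x, g x) ^ b ≤ ∫⁻ x, h x := by
  induction d with
  | zero =>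
    intro f g h hf hg hh H
    have hi (f : (Fin 0 → ℝ) → ℝ≥0∞) : ∫⁻ x, f x = f 0 := by
      rw [volume_pi, Measure.pi_of_empty _ 0, lintegral_dirac]
    rw [hi, hi, hi]
    simpa using H 0 0
  | succ d ih =>
    intro f g h hf hg hh H
    have hmp := (volume_preserving_piFinSuccAbove (fun _ : Fin (d+1) => ℝ) 0).symm
    set e := (MeasurableEquiv.piFinSuccAbove (fun _ : Fin (d+1) => ℝ) 0).symm with he
    have hi {f : (Fin (d+1) → ℝ) → ℝ≥0∞} (hf : Measurable f) :
        ∫⁻ x, f x = ∫⁻ s : ℝ, ∫⁻ y : Fin d → ℝ, f (e (s, y)) := by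
      rw [← hmp.lintegral_comp hf]
      exact lintegral_prod _ (hf.comp e.measurable).aemeasurable
    have hm {f : (Fin (d+1) → ℝ) → ℝ≥0∞} (hf : Measurable f) :
        Measurable fun s : ℝ => ∫⁻ y : Fin d → ℝ, f (e (s, y)) :=
      (hf.comp e.measurable).lintegral_prod_right'
    rw [hi hf, hi hg, hi hh]
    refine pl1 ha hb hab (hm hf) (hm hg) (hm hh) fun s t => ?_
    refine ih (hf.comp (e.measurable.comp (by fun_prop))) (hg.comp (e.measurable.comp (by fun_prop)))
      (hh.comp (e.measurable.comp (by fun_prop))) fun x y => ?_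
    convert H (e (s, x)) (e (t, y)) using 2
    ext i
    refine Fin.cases ?_ (fun j => ?_) i <;> simp [he, MeasurableEquiv.piFinSuccAbove]

lemma bm_min {a b : ℝ} (ha : 0 < a) (hb : 0 < b) (hab : a + b = 1) {d : ℕ}
    {A B C : Set (Fin d → ℝ)} (hA : MeasurableSet A) (hB : MeasurableSet B) (hC : MeasurableSet C)
    (H : ∀ x ∈ A, ∀ y ∈ B, a • x + b • y ∈ C) {r : ℝ≥0∞} (h1 : r < volume A) (h2 : r < volume B) :
    r < volume C := by
  have := pln ha hb hab d (f := indicator A 1) (g := indicator B 1) (h := indicator C 1)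
    (measurable_one.indicator hA) (measurable_one.indicator hB) (measurable_one.indicator hC) (by
      intro x y
      by_cases hx : x ∈ A
      · by_cases hy : y ∈ B
        · simp [hx, hy, H x hx y hy]
        · simp [hy, hb]
      · simp [hx, ha])
  simp only [lintegral_indicator_one, hA, hB, hC] at this
  refine lt_of_lt_of_le ?_ this
  calc r = r ^ a * r ^ b := by
              rw [← ENNReal.rpow_add_of_nonneg _ _ ha.le hb.le, hab, ENNReal.rpow_one]
    _ < _ := ENNReal.mul_lt_mul (ENNReal.rpow_lt_rpow h1 ha) (ENNReal.rpow_lt_rpow h2 hb)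

lemma rearr_lt {α : Type*} [MeasurableSpace α] (μ : Measure α) (A : Set α) (f : α → ℝ≥0∞)
    (r : ℝ≥0∞) {T : ℝ≥0∞} (hT : T < ⊤) :
    (T < ⨆ s : ℝ≥0∞, ⨆ (_ : r < μ (A ∩ {x | s ≤ f x})), s) ↔ r < μ (A ∩ {x | T < f x}) := by
  constructor
  · intro h
    simp only [lt_iSup_iff] at h
    obtain ⟨s, hs, hTs⟩ := h
    refine hs.trans_le (measure_mono ?_)
    rintro x ⟨hx, hx'⟩
    exact ⟨hx, lt_of_lt_of_le hTs hx'⟩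
  · intro h
    obtain ⟨v, hv, hv1, hv2⟩ := exists_seq_strictAnti_tendsto' hT
    have hU : A ∩ {x | T < f x} = ⋃ n, A ∩ {x | v n ≤ f x} := by
      ext x
      simp only [mem_inter_iff, mem_iUnion, mem_ofPred_eq, exists_and_left, and_congr_right_iff]
      intro _
      constructor
      · intro hx
        exact ((hv2.eventually_lt_const hx).exists).imp fun _ h => h.le
      · rintro ⟨n, hn⟩
        exact (hv1 n).1.trans_le hn
    have hmono : Monotone fun n => A ∩ {x | v n ≤ f x} := by
      rintro n m hnm x ⟨hx, hx'⟩
      exact ⟨hx, (hv.antitone hnm).trans hx'⟩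
    rw [hU, hmono.measure_iUnion, lt_iSup_iff] at h
    obtain ⟨n, hn⟩ := h
    simp only [lt_iSup_iff]
    exact ⟨v n, hn, (hv1 n).1⟩

lemma rearr_int {α : Type*} [MeasurableSpace α] (μ : Measure α) [SFinite μ] {A : Set α}
    (hA : MeasurableSet A) {f : α → ℝ≥0∞} (hf : Measurable f) :
    Measurable (fun r : ℝ => ⨆ s : ℝ≥0∞, ⨆ (_ : ENNReal.ofReal r < μ (A ∩ {x | s ≤ f x})), s) ∧
    ∫⁻ x in A, f x ∂μ = ∫⁻ r in Ioi (0:ℝ),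
      ⨆ s : ℝ≥0∞, ⨆ (_ : ENNReal.ofReal r < μ (A ∩ {x | s ≤ f x})), s := by
  have hm : Measurable
      (fun r : ℝ => ⨆ s : ℝ≥0∞, ⨆ (_ : ENNReal.ofReal r < μ (A ∩ {x | s ≤ f x})), s) := by
    apply Antitone.measurable
    intro r r' hrr
    refine iSup_le fun s => iSup_le fun hs => ?_
    exact le_iSup₂_of_le s ((ENNReal.ofReal_le_ofReal hrr).trans_lt hs) le_rfl
  refine ⟨hm, ?_⟩
  rw [layer _ hf, layer _ hm]
  refine lintegral_congr fun t => ?_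
  rw [Measure.restrict_apply (measurableSet_lt (by fun_prop) (by fun_prop)),
    Measure.restrict_apply (measurableSet_lt (by fun_prop) hm)]
  simp_rw [rearr_lt μ A f _ (ENNReal.ofReal_lt_top (r := t))]
  rw [inter_comm, inter_comm _ (Ioi _), vol_lt]

lemma core {a b : ℝ} (ha : 0 < a) (hb : 0 < b) (hab : a + b = 1) {d : ℕ}
    {K L M : Set ((Fin d → ℝ) × ℝ)} (hK : MeasurableSet K) (hL : MeasurableSet L)
    (hM : MeasurableSet M) (hK' : MeasurableSet (Prod.fst '' K))
    (hL' : MeasurableSet (Prod.fst '' L))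
    (H : ∀ x ∈ K, ∀ y ∈ L, a • x + b • y ∈ M)
    (hv : volume (Prod.fst '' K) = volume (Prod.fst '' L)) :
    ENNReal.ofReal a * volume K + ENNReal.ofReal b * volume L ≤ volume M := by
  set f : (Fin d → ℝ) → ℝ≥0∞ := fun x => volume (Prod.mk x ⁻¹' K) with hf
  set g : (Fin d → ℝ) → ℝ≥0∞ := fun x => volume (Prod.mk x ⁻¹' L) with hg
  set h : (Fin d → ℝ) → ℝ≥0∞ := fun x => volume (Prod.mk x ⁻¹' M) with hh
  have mf : Measurable f := measurable_measure_prodMk_left hK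
  have mg : Measurable g := measurable_measure_prodMk_left hL
  have mh : Measurable h := measurable_measure_prodMk_left hM
  have hH : ∀ x ∈ Prod.fst '' K, ∀ y ∈ Prod.fst '' L,
      ENNReal.ofReal a * f x + ENNReal.ofReal b * g y ≤ h (a • x + b • y) := by
    rintro _ ⟨⟨x, s⟩, hx, rfl⟩ _ ⟨⟨y, t⟩, hy, rfl⟩
    exact bm_scaled ha hb (measurable_prodMk_left hK) (measurable_prodMk_left hL) ⟨s, hx⟩ ⟨t, hy⟩
      fun s hs t ht => H _ hs _ ht
  have I1 {K : Set ((Fin d → ℝ) × ℝ)} (hK : MeasurableSet K) (hK' : MeasurableSet (Prod.fst '' K)) :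
      volume K = ∫⁻ x in Prod.fst '' K, volume (Prod.mk x ⁻¹' K) := by
    rw [Measure.volume_eq_prod, Measure.prod_apply hK, setLIntegral_eq_of_support_subset]
    intro x hx
    have : (Prod.mk x ⁻¹' K).Nonempty := by
      by_contra hne
      rw [not_nonempty_iff_eq_empty] at hne
      simp [hne] at hx
    obtain ⟨t, ht⟩ := this
    exact ⟨(x, t), ht, rfl⟩
  have I2 : volume M = ∫⁻ x in univ, h x := by
    rw [Measure.volume_eq_prod, Measure.prod_apply hM, setLIntegral_univ]
  rw [I1 hK hK', I1 hL hL', I2, (rearr_int _ hK' mf).2, (rearr_int _ hL' mg).2,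
    (rearr_int _ MeasurableSet.univ mh).2, ← lintegral_const_mul' _ _ (by simp),
    ← lintegral_const_mul' _ _ (by simp),
    ← lintegral_add_left' ((rearr_int _ hK' mf).1.const_mul _).aemeasurable]
  refine lintegral_mono fun r => ?_
  dsimp only
  by_cases hr : ENNReal.ofReal r < volume (Prod.fst '' K)
  · simp_rw [ENNReal.mul_iSup]
    refine ENNReal.biSup_add_biSup_le' ⟨0, by simpa using hr⟩ ⟨0, by simpa [← hv] using hr⟩ ?_
    intro s hs t ht
    refine le_iSup₂_of_le (ENNReal.ofReal a * s + ENNReal.ofReal b * t) ?_ le_rfl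
    refine bm_min ha hb hab (hK'.inter (measurableSet_le (by fun_prop) mf))
      (hL'.inter (measurableSet_le (by fun_prop) mg))
      (MeasurableSet.univ.inter (measurableSet_le (by fun_prop) mh)) ?_ hs ht
    rintro x ⟨hx, hx'⟩ y ⟨hy, hy'⟩
    refine ⟨mem_univ _, le_trans ?_ (hH x hx y hy)⟩
    simp only [mem_ofPred_eq] at hx' hy'
    gcongr
  · have e1 (S : Set (Fin d → ℝ)) : ¬ ENNReal.ofReal r < volume (Prod.fst '' K ∩ S) :=
      fun h => hr (h.trans_le (measure_mono inter_subset_left))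
    have e2 (S : Set (Fin d → ℝ)) : ¬ ENNReal.ofReal r < volume (Prod.fst '' L ∩ S) :=
      fun h => hr (h.trans_le ((measure_mono inter_subset_left).trans hv.ge))
    simp [e1, e2]

theorem stmt1 (n : ℕ) (hn : 2 ≤ n)
    (u : EuclideanSpace ℝ (Fin n)) (hu : ‖u‖ = 1)
    (K L : Set (EuclideanSpace ℝ (Fin n)))
    (hKc : IsCompact K) (hKconv : Convex ℝ K) (hKne : K.Nonempty)
    (hLc : IsCompact L) (hLconv : Convex ℝ L) (hLne : L.Nonempty)
    (hprojpos : 0 < μH[(n : ℝ) - 1] (projPerp u K))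
    (hproj : μH[(n : ℝ) - 1] (projPerp u K) = μH[(n : ℝ) - 1] (projPerp u L)) :
    ∀ l ∈ Set.Icc (0 : ℝ) 1,
      ENNReal.ofReal (1 - l) * μH[(n : ℝ)] K + ENNReal.ofReal l * μH[(n : ℝ)] L ≤
        μH[(n : ℝ)] ((1 - l) • K + l • L) := by
  intro l hl
  rcases eq_or_lt_of_le hl.1 with h0 | h0
  · subst h0
    simp [zero_smul_set hLne]
  rcases eq_or_lt_of_le hl.2 with h1 | h1
  · subst h1
    simp [zero_smul_set hKne]
  obtain ⟨d, rfl⟩ : ∃ d, n = d + 1 := ⟨n - 1, by omega⟩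
  have hE : Measure.IsAddHaarMeasure
      (μH[((d + 1 : ℕ) : ℝ)] : Measure (EuclideanSpace ℝ (Fin (d + 1)))) := by
    have := isAddHaarMeasure_hausdorffMeasure (E := EuclideanSpace ℝ (Fin (d + 1)))
    rwa [finrank_euclideanSpace_fin] at this
  have hV : Measure.IsAddHaarMeasure (μH[(d : ℝ)] : Measure (EuclideanSpace ℝ (Fin d))) := by
    have := isAddHaarMeasure_hausdorffMeasure (E := EuclideanSpace ℝ (Fin d))
    rwa [finrank_euclideanSpace_fin] at this
  have hu0 : u ≠ 0 := by rintro rfl; simp at hu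
  have huu : ⟪u, u⟫ = 1 := by rw [real_inner_self_eq_norm_sq, hu]; norm_num
  have : Fact (Module.finrank ℝ (EuclideanSpace ℝ (Fin (d + 1))) = d + 1) := ⟨by simp⟩
  let B := OrthonormalBasis.fromOrthogonalSpanSingleton (𝕜 := ℝ) d hu0
  let ι : EuclideanSpace ℝ (Fin d) →ₗᵢ[ℝ] EuclideanSpace ℝ (Fin (d + 1)) :=
    (ℝ ∙ u)ᗮ.subtypeₗᵢ.comp B.repr.symm.toLinearIsometry
  have hι (x) : ⟪ι x, u⟫ = 0 := by
    have : ι x ∈ (ℝ ∙ u)ᗮ := (B.repr.symm x).2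
    rw [Submodule.mem_orthogonal_singleton_iff_inner_left] at this
    exact this
  let e0 : (Fin d → ℝ) ≃L[ℝ] EuclideanSpace ℝ (Fin d) := (EuclideanSpace.equiv (Fin d) ℝ).symm
  let T0 : ((Fin d → ℝ) × ℝ) →ₗ[ℝ] EuclideanSpace ℝ (Fin (d + 1)) :=
    (ι.toLinearMap.comp e0.toLinearEquiv.toLinearMap).coprod (LinearMap.toSpanSingleton ℝ _ u)
  have hT0 (p) : T0 p = ι (e0 p.1) + p.2 • u := by simp [T0]
  have hin (p) : ⟪T0 p, u⟫ = p.2 := by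
    rw [hT0, inner_add_left, hι, inner_smul_left, huu]; simp
  have hpr (p) : T0 p - ⟪T0 p, u⟫ • u = ι (e0 p.1) := by
    rw [hin, hT0]; simp
  have hinj : Function.Injective T0 := by
    intro p q hpq
    have h2 : p.2 = q.2 := by rw [← hin, hpq, hin]
    have h3 : ι (e0 p.1) = ι (e0 q.1) := by rw [← hpr, hpq, hpr]
    exact Prod.ext (e0.injective (ι.injective h3)) h2
  let T : ((Fin d → ℝ) × ℝ) ≃L[ℝ] EuclideanSpace ℝ (Fin (d + 1)) :=
    (LinearEquiv.ofInjectiveOfFinrankEq T0 hinj (by simp)).toContinuousLinearEquiv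
  have hT (p) : T p = T0 p := rfl
  -- projections
  have hfst (S : Set (EuclideanSpace ℝ (Fin (d + 1)))) :
      projPerp u S = ι '' (e0 '' (Prod.fst '' (T ⁻¹' S))) := by
    unfold projPerp
    ext x
    constructor
    · rintro ⟨y, hy, rfl⟩
      refine ⟨_, ⟨_, ⟨T.symm y, by simpa using hy, rfl⟩, rfl⟩, ?_⟩
      rw [← hpr, ← hT]; simp
    · rintro ⟨_, ⟨_, ⟨p, hp, rfl⟩, rfl⟩, rfl⟩
      exact ⟨T p, hp, hpr p⟩
  have hνH := ContinuousLinearEquiv.isAddHaarMeasure_map e0.symm (μH[(d : ℝ)])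
  have hν (S : Set (Fin d → ℝ)) : (Measure.map e0.symm (μH[(d : ℝ)])) S =
      μH[(d : ℝ)] (ι '' (e0 '' S)) := by
    rw [ι.isometry.hausdorffMeasure_image (.inl (by positivity)),
      e0.image_eq_preimage_symm S]
    exact e0.symm.toHomeomorph.toMeasurableEquiv.map_apply S
  have hvol (S : Set (Fin d → ℝ)) := congrArg (fun m : Measure (Fin d → ℝ) => m S)
    (Measure.isAddLeftInvariant_eq_smul volume (Measure.map e0.symm (μH[(d : ℝ)])))
  simp only [Measure.smul_apply, hν] at hvol
  have hd : (((d + 1 : ℕ) : ℝ) - 1) = d := by push_cast; ring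
  rw [hd, hfst, hfst] at hproj
  have hpe : volume (Prod.fst '' (T ⁻¹' K)) = volume (Prod.fst '' (T ⁻¹' L)) := by
    rw [hvol, hvol, hproj]
  -- full measure
  have hμH := ContinuousLinearEquiv.isAddHaarMeasure_map T.symm (μH[((d + 1 : ℕ) : ℝ)])
  have hμ (S : Set (EuclideanSpace ℝ (Fin (d + 1)))) :
      μH[((d + 1 : ℕ) : ℝ)] S = (Measure.map T.symm (μH[((d + 1 : ℕ) : ℝ)])) (T ⁻¹' S) := by
    refine Eq.trans ?_ (T.symm.toHomeomorph.toMeasurableEquiv.map_apply (T ⁻¹' S)).symm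
    congr 1
    ext x
    simp
  have hvp : Measure.IsAddHaarMeasure (volume : Measure ((Fin d → ℝ) × ℝ)) := by
    rw [Measure.volume_eq_prod]; infer_instance
  rw [Measure.isAddLeftInvariant_eq_smul (Measure.map T.symm (μH[((d + 1 : ℕ) : ℝ)])) volume] at hμ
  have hc {S : Set (EuclideanSpace ℝ (Fin (d + 1)))} (hS : IsCompact S) : IsCompact (T ⁻¹' S) :=
    T.toHomeomorph.isCompact_preimage.2 hS
  have hMc : IsCompact ((1 - l) • K + l • L) := (hKc.smul _).add (hLc.smul _)
  have key := core (a := 1 - l) (b := l) (by linarith) h0 (by ring)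
    (hc hKc).measurableSet (hc hLc).measurableSet (hc hMc).measurableSet
    ((hc hKc).image continuous_fst).measurableSet ((hc hLc).image continuous_fst).measurableSet
    (fun x hx y hy => by
      simp only [mem_preimage, map_add, map_smul]
      exact add_mem_add (smul_mem_smul_set hx) (smul_mem_smul_set hy)) hpe
  simp only [hμ, Measure.smul_apply, ENNReal.smul_def, smul_eq_mul]
  rw [mul_left_comm, mul_left_comm (ENNReal.ofReal l), ← mul_add]
  gcongr
end
end

section
/- Let n ≥ 3, u ∈ S^{n-1}, and let K, L be convex bodies in R^n such that the orthogonal projections P_{u^⊥}(K) and P_{u^⊥}(L) are homothetic (n-1)-dimensional convex bodies (i.e., P_{u^⊥}(K) = μ·P_{u^⊥}(L) + a for some μ > 0 and a ∈ R^n). Then H^n(K+L)/H^{n-1}(P_{u^⊥}(K+L)) ≥ H^n(K)/H^{n-1}(P_{u^⊥}(K)) + H^n(L)/H^{n-1}(P_{u^⊥}(L)). -/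
open MeasureTheory Set Pointwise Filter
open scoped ENNReal RealInnerProductSpace

noncomputable section

theorem vol_add_le_real (A B : Set ℝ) (hA : IsCompact A) (hB : IsCompact B)
    (hAn : A.Nonempty) (hBn : B.Nonempty) : volume A + volume B ≤ volume (A + B) := by
  obtain ⟨a, haA, ha⟩ := hA.exists_isGreatest hAn
  obtain ⟨b, hbB, hb⟩ := hB.exists_isLeast hBn
  have h1 : volume ((fun x => x + b) '' A) = volume A := by simp
  have h2 : volume ((fun x => a + x) '' B) = volume B := by simp
  have hm : MeasurableSet ((fun x => a + x) '' B) :=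
    (hB.image (by fun_prop)).isClosed.measurableSet
  have hI : volume (((fun x => x + b) '' A) ∩ ((fun x => a + x) '' B)) = 0 := by
    refine measure_mono_null (t := {a + b}) ?_ (by simp)
    rintro _ ⟨⟨x, hx, rfl⟩, ⟨y, hy, hxy⟩⟩
    have := ha hx
    have := hb hy
    simp only [mem_singleton_iff] at *
    linarith
  have h3 := measure_union_add_inter (μ := volume) ((fun x => x + b) '' A) hm
  rw [hI, h1, h2, add_zero] at h3
  rw [← h3]
  apply measure_mono
  rintro _ (⟨x, hx, rfl⟩ | ⟨y, hy, rfl⟩)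
  · exact add_mem_add hx hbB
  · exact add_mem_add haA hy

theorem lintegral_affine {F : Type*} [NormedAddCommGroup F] [NormedSpace ℝ F]
    [FiniteDimensional ℝ F] [MeasurableSpace F] [BorelSpace F] (ν : Measure F)
    [ν.IsAddHaarMeasure] (f : F → ℝ≥0∞) (hf : Measurable f) {r : ℝ} (hr : 0 < r) (a : F) :
    ENNReal.ofReal (r ^ Module.finrank ℝ F) * ∫⁻ z, f (r • z + a) ∂ν = ∫⁻ z, f z ∂ν := by
  have h1 : ∫⁻ z, f (r • z + a) ∂ν = ∫⁻ z, f (z + a) ∂(Measure.map (r • ·) ν) := by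
    rw [lintegral_map (by fun_prop) (by fun_prop)]
  have hp : 0 < r ^ Module.finrank ℝ F := by positivity
  rw [h1, Measure.map_addHaar_smul ν hr.ne', lintegral_smul_measure, lintegral_add_right_eq_self,
    smul_eq_mul, ← mul_assoc, ← ENNReal.ofReal_mul hp.le, abs_of_pos (by positivity),
    mul_inv_cancel₀ hp.ne']
  simp

theorem fubini_perp {n : ℕ} (u : EuclideanSpace ℝ (Fin n)) (hu : ‖u‖ = 1) :
    ∃ c : ℝ≥0∞, ∀ K : Set (EuclideanSpace ℝ (Fin n)), IsCompact K →
      Measurable (fun y : (ℝ ∙ u)ᗮ => volume {t : ℝ | (y : EuclideanSpace ℝ (Fin n)) + t • u ∈ K}) ∧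
      μH[(n : ℝ)] K = c * ∫⁻ y : (ℝ ∙ u)ᗮ,
        volume {t : ℝ | (y : EuclideanSpace ℝ (Fin n)) + t • u ∈ K} := by
  have huu : ⟪u, u⟫ = (1 : ℝ) := by simp [real_inner_self_eq_norm_sq, hu]
  let g : ((ℝ ∙ u)ᗮ × ℝ) →ₗ[ℝ] EuclideanSpace ℝ (Fin n) :=
    ((ℝ ∙ u)ᗮ.subtype).coprod (LinearMap.toSpanSingleton ℝ _ u)
  have hg : ∀ p, g p = (p.1 : EuclideanSpace ℝ (Fin n)) + p.2 • u := fun p => by simp [g]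
  have hbij : Function.Bijective g := by
    constructor
    · rw [injective_iff_map_eq_zero]
      rintro ⟨y, t⟩ h
      rw [hg] at h
      have hy : ⟪u, (y : EuclideanSpace ℝ (Fin n))⟫ = (0 : ℝ) :=
        Submodule.mem_orthogonal_singleton_iff_inner_right.1 y.2
      have h2 := congrArg (fun z => ⟪u, z⟫) h
      simp only [inner_add_right, inner_smul_right, huu, hy, inner_zero_right] at h2
      have ht : t = 0 := by linarith
      subst ht
      simp at h
      simp [h]
    · intro x
      refine ⟨⟨⟨x - ⟪x, u⟫ • u, ?_⟩, ⟪x, u⟫⟩, ?_⟩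
      · rw [Submodule.mem_orthogonal_singleton_iff_inner_right, inner_sub_right, inner_smul_right,
          huu, real_inner_comm]
        ring
      · rw [hg]; simp
  let e : ((ℝ ∙ u)ᗮ × ℝ) ≃L[ℝ] EuclideanSpace ℝ (Fin n) :=
    (LinearEquiv.ofBijective g hbij).toContinuousLinearEquiv
  have he : ∀ p, e p = (p.1 : EuclideanSpace ℝ (Fin n)) + p.2 • u := hg
  have hH : (μH[(n : ℝ)] : Measure (EuclideanSpace ℝ (Fin n))).IsAddHaarMeasure := by
    simpa using MeasureTheory.isAddHaarMeasure_hausdorffMeasure (E := EuclideanSpace ℝ (Fin n))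
  let ρ : Measure (EuclideanSpace ℝ (Fin n)) :=
    Measure.map e ((volume : Measure (ℝ ∙ u)ᗮ).prod (volume : Measure ℝ))
  have hρ : ρ.IsAddHaarMeasure := ContinuousLinearEquiv.isAddHaarMeasure_map e _
  refine ⟨Measure.addHaarScalarFactor μH[(n : ℝ)] ρ, fun K hK => ?_⟩
  have hm : MeasurableSet (e ⁻¹' K) := e.continuous.measurable hK.measurableSet
  have hset : ∀ y : (ℝ ∙ u)ᗮ, {t : ℝ | (y : EuclideanSpace ℝ (Fin n)) + t • u ∈ K}
      = Prod.mk y ⁻¹' (e ⁻¹' K) := by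
    intro y; ext t; simp [he]
  simp only [hset]
  refine ⟨measurable_measure_prodMk_left hm, ?_⟩
  rw [← Measure.prod_apply hm, ← Measure.map_apply e.continuous.measurable hK.measurableSet]
  conv_lhs => rw [Measure.isAddLeftInvariant_eq_smul μH[(n : ℝ)] ρ]
  rfl

theorem hausdorff_affine {n : ℕ} (hn : 1 ≤ n) (S : Set (EuclideanSpace ℝ (Fin n))) {r : ℝ}
    (hr : 0 < r) (a : EuclideanSpace ℝ (Fin n)) :
    μH[(n : ℝ) - 1] ((fun x => r • x + a) '' S)
      = ENNReal.ofReal (r ^ (n - 1)) * μH[(n : ℝ) - 1] S := by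
  have hd : (0 : ℝ) ≤ (n : ℝ) - 1 := by
    have : (1 : ℝ) ≤ n := by exact_mod_cast hn
    linarith
  have h1 : (fun x => r • x + a) '' S = (fun x => x + a) '' (r • S) := by
    rw [← image_smul, image_image]
  have h2 : ((n : ℝ) - 1) = ((n - 1 : ℕ) : ℝ) := by push_cast [hn]; ring
  rw [h1, (isometry_add_right a).hausdorffMeasure_image (Or.inl hd),
    Measure.hausdorffMeasure_smul₀ hd hr.ne', h2, NNReal.rpow_natCast, ENNReal.smul_def,
    smul_eq_mul]
  congr 1
  rw [ENNReal.coe_pow, ENNReal.ofReal_pow hr.le, ← enorm_eq_nnnorm, Real.enorm_eq_ofReal hr.le]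

theorem stmt2 (n : ℕ) (hn : 3 ≤ n)
    (u : EuclideanSpace ℝ (Fin n)) (hu : ‖u‖ = 1)
    (K L : Set (EuclideanSpace ℝ (Fin n)))
    (hKc : IsCompact K) (hKconv : Convex ℝ K) (hKne : K.Nonempty)
    (hLc : IsCompact L) (hLconv : Convex ℝ L) (hLne : L.Nonempty)
    (hKdim : Module.finrank ℝ (affineSpan ℝ (projPerp u K)).direction = n - 1)
    (hLdim : Module.finrank ℝ (affineSpan ℝ (projPerp u L)).direction = n - 1)
    (hhom : ∃ μ : ℝ, 0 < μ ∧ ∃ a : EuclideanSpace ℝ (Fin n),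
      projPerp u K = (fun x => μ • x + a) '' projPerp u L) :
    μH[(n : ℝ)] K / μH[(n : ℝ) - 1] (projPerp u K) +
        μH[(n : ℝ)] L / μH[(n : ℝ) - 1] (projPerp u L) ≤
      μH[(n : ℝ)] (K + L) / μH[(n : ℝ) - 1] (projPerp u (K + L)) := by
  obtain ⟨μ, hμ, a, ha⟩ := hhom
  obtain ⟨c, hc⟩ := fubini_perp u hu
  have huu : ⟪u, u⟫ = (1 : ℝ) := by simp [real_inner_self_eq_norm_sq, hu]
  have hperp : ∀ S, ∀ x ∈ projPerp u S, x ∈ (ℝ ∙ u)ᗮ := by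
    rintro S _ ⟨x, hx, rfl⟩
    rw [Submodule.mem_orthogonal_singleton_iff_inner_right, inner_sub_right, inner_smul_right,
      huu, real_inner_comm]
    ring
  have hmem : ∀ S, ∀ y ∈ (ℝ ∙ u)ᗮ, y ∈ projPerp u S ↔ ∃ t : ℝ, y + t • u ∈ S := by
    intro S y hy
    have hy' : ⟪y, u⟫ = (0 : ℝ) := Submodule.mem_orthogonal_singleton_iff_inner_left.1 hy
    constructor
    · rintro ⟨x, hx, rfl⟩
      exact ⟨⟪x, u⟫, by simpa using hx⟩
    · rintro ⟨t, ht⟩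
      refine ⟨_, ht, ?_⟩
      simp only [inner_add_left, inner_smul_left, huu, hy']
      simp
  have haF : a ∈ (ℝ ∙ u)ᗮ := by
    obtain ⟨l, hl⟩ := hLne
    have hl' : l - ⟪l, u⟫ • u ∈ projPerp u L := ⟨l, hl, rfl⟩
    have h1 := hperp L _ hl'
    have h2 : μ • (l - ⟪l, u⟫ • u) + a ∈ projPerp u K := by
      rw [ha]; exact ⟨_, hl', rfl⟩
    have h3 := hperp K _ h2
    exact (Submodule.add_mem_iff_right _ (Submodule.smul_mem _ _ h1)).1 h3
  have hfin : Module.finrank ℝ (ℝ ∙ u)ᗮ = n - 1 := by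
    have h1 := Submodule.finrank_add_finrank_orthogonal (ℝ ∙ u)
    have hu0 : u ≠ 0 := by rintro rfl; simp at hu
    rw [finrank_span_singleton hu0, finrank_euclideanSpace_fin] at h1
    omega
  have hKL : IsCompact (K + L) := hKc.add hLc
  have hMconv : Convex ℝ (projPerp u L) := by
    have h : IsLinearMap ℝ (fun x : EuclideanSpace ℝ (Fin n) => x - ⟪x, u⟫ • u) := by
      constructor
      · intro x y; rw [inner_add_left]; module
      · intro r x
        rw [real_inner_smul_left]; module
    exact hLconv.is_linear_image h
  have hsum : projPerp u (K + L) = (fun x => (1 + μ) • x + a) '' projPerp u L := by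
    have h1 : projPerp u (K + L) = projPerp u K + projPerp u L := by
      ext x
      constructor
      · rintro ⟨_, ⟨k, hk, l, hl, rfl⟩, rfl⟩
        refine ⟨_, ⟨k, hk, rfl⟩, _, ⟨l, hl, rfl⟩, ?_⟩
        simp only [inner_add_left]; module
      · rintro ⟨_, ⟨k, hk, rfl⟩, _, ⟨l, hl, rfl⟩, rfl⟩
        refine ⟨_, ⟨k, hk, l, hl, rfl⟩, ?_⟩
        simp only [inner_add_left]; module
    rw [h1, ha]
    ext x
    constructor
    · rintro ⟨_, ⟨y, hy, rfl⟩, z, hz, rfl⟩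
      have : μ • y + (1 : ℝ) • z ∈ (μ + 1) • projPerp u L := by
        rw [hMconv.add_smul hμ.le zero_le_one]
        exact add_mem_add (smul_mem_smul_set hy) (smul_mem_smul_set hz)
      obtain ⟨w, hw, hw'⟩ := this
      refine ⟨w, hw, ?_⟩
      simp only at hw' ⊢
      rw [add_comm 1 μ, hw']; module
    · rintro ⟨y, hy, rfl⟩
      exact ⟨_, ⟨y, hy, rfl⟩, y, hy, by simp only; module⟩
  have hμ1 : 0 < 1 + μ := by linarith
  have hn1 : 1 ≤ n := by omega
  rw [hsum, ha, hausdorff_affine hn1 _ hμ, hausdorff_affine hn1 _ hμ1]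
  set f : Set (EuclideanSpace ℝ (Fin n)) → (ℝ ∙ u)ᗮ → ℝ≥0∞ :=
    fun S y => volume {t : ℝ | (y : EuclideanSpace ℝ (Fin n)) + t • u ∈ S} with hf
  have hpt : ∀ z : (ℝ ∙ u)ᗮ, f K (μ • z + ⟨a, haF⟩) + f L z ≤
      f (K + L) ((1 + μ) • z + ⟨a, haF⟩) := by
    intro z
    have hcpt : ∀ S, IsCompact S → ∀ y : EuclideanSpace ℝ (Fin n),
        IsCompact {t : ℝ | y + t • u ∈ S} := by
      intro S hS y
      have hi : Isometry (fun t : ℝ => y + t • u) := by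
        refine Isometry.of_dist_eq fun s t => ?_
        rw [dist_add_left, dist_eq_norm, ← sub_smul, norm_smul, hu, mul_one, Real.dist_eq,
          Real.norm_eq_abs]
      exact hi.isClosedEmbedding.isCompact_preimage hS
    by_cases hz : (z : EuclideanSpace ℝ (Fin n)) ∈ projPerp u L
    · have hz2 : μ • (z : EuclideanSpace ℝ (Fin n)) + a ∈ projPerp u K := by
        rw [ha]; exact ⟨_, hz, rfl⟩
      have hL1 := (hmem L _ z.2).1 hz
      have hK1 := (hmem K _ (hperp K _ hz2)).1 hz2
      refine (vol_add_le_real _ _ (hcpt K hKc _) (hcpt L hLc _) hK1 hL1).trans ?_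
      apply measure_mono
      rintro _ ⟨s, hs, t, ht, rfl⟩
      refine ⟨_, hs, _, ht, ?_⟩
      simp only [Submodule.coe_add, Submodule.coe_smul]
      module
    · have hz2 : μ • (z : EuclideanSpace ℝ (Fin n)) + a ∉ projPerp u K := by
        rw [ha]
        rintro ⟨w, hw, hw'⟩
        have : w = z := smul_right_injective _ hμ.ne' (add_right_cancel hw')
        exact hz (this ▸ hw)
      have e1 : f L z = 0 := by
        have : {t : ℝ | (z : EuclideanSpace ℝ (Fin n)) + t • u ∈ L} = ∅ := by
          ext t
          simp only [mem_setOf_eq, mem_empty_iff_false, iff_false]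
          exact fun h => hz ((hmem L _ z.2).2 ⟨t, h⟩)
        simp only [hf, this, measure_empty]
      have e2 : f K (μ • z + ⟨a, haF⟩) = 0 := by
        have : {t : ℝ | ((μ • z + ⟨a, haF⟩ : (ℝ ∙ u)ᗮ) : EuclideanSpace ℝ (Fin n)) + t • u ∈ K}
            = ∅ := by
          ext t
          simp only [mem_setOf_eq, mem_empty_iff_false, iff_false]
          exact fun h => hz2 ((hmem K _ (μ • z + ⟨a, haF⟩ : (ℝ ∙ u)ᗮ).2).2 ⟨t, h⟩)
        simp only [hf, this, measure_empty]
      rw [e1, e2]; simp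
  have hIK := lintegral_affine volume (f K) (hc K hKc).1 hμ ⟨a, haF⟩
  have hIKL := lintegral_affine volume (f (K + L)) (hc _ hKL).1 hμ1 ⟨a, haF⟩
  have hint := lintegral_mono (μ := volume) hpt
  rw [lintegral_add_right _ (hc L hLc).1] at hint
  rw [hfin] at hIK hIKL
  rw [(hc K hKc).2, (hc L hLc).2, (hc _ hKL).2]
  change c * (∫⁻ y, f K y) / _ + c * (∫⁻ y, f L y) / _ ≤ c * (∫⁻ y, f (K + L) y) / _
  rw [← hIK, ← hIKL]
  have key : ∀ (r : ℝ), 0 < r → ∀ I m : ℝ≥0∞,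
      c * (ENNReal.ofReal (r ^ (n - 1)) * I) / (ENNReal.ofReal (r ^ (n - 1)) * m) = c * I / m := by
    intro r hr I m
    rw [mul_left_comm]
    exact ENNReal.mul_div_mul_left _ _ (by simpa using pow_pos hr _) ENNReal.ofReal_ne_top
  rw [key μ hμ, key _ hμ1, ← ENNReal.add_div, ← mul_add]
  gcongr
end
end

section
/- For every n ≥ 3 there exist full-dimensional convex bodies K, L ⊂ R^n and a unit vector u ∈ S^{n-1} with H^{n-1}(P_{u^⊥}(K)) = H^{n-1}(P_{u^⊥}(L)) ≠ 0 such that H^n(K+L)/H^{n-1}(P_{u^⊥}(K+L)) < H^n(K)/H^{n-1}(P_{u^⊥}(K)) + H^n(L)/H^{n-1}(P_{u^⊥}(L)). -/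
open MeasureTheory Set Pointwise Filter
open scoped ENNReal RealInnerProductSpace

noncomputable section

/-- Region over `[0,a]` whose fibres are boxes with sides `[0, w i t]`. -/
def T5 (k : ℕ) (a : ℝ) (w : Fin k → ℝ → ℝ) : Set (EuclideanSpace ℝ (Fin (k + 1))) :=
  {x | (0 ≤ x 0 ∧ x 0 ≤ a) ∧ ∀ i : Fin k, 0 ≤ x i.succ ∧ x i.succ ≤ w i (x 0)}

theorem T5_closed (k : ℕ) (a : ℝ) (w : Fin k → ℝ → ℝ) (hw : ∀ i, Continuous (w i)) :
    IsClosed (T5 k a w) := by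
  have h0 : ∀ i, Continuous fun x : EuclideanSpace ℝ (Fin (k + 1)) => x i := by
    intro i; fun_prop
  unfold T5
  simp only [ofPred_and, ofPred_forall]
  refine IsClosed.inter (IsClosed.inter ?_ ?_) (isClosed_iInter fun i => IsClosed.inter ?_ ?_)
  · exact isClosed_le continuous_const (h0 0)
  · exact isClosed_le (h0 0) continuous_const
  · exact isClosed_le continuous_const (h0 _)
  · exact isClosed_le (h0 _) ((hw i).comp (h0 0))

theorem T5_compact (k : ℕ) (a : ℝ) (w : Fin k → ℝ → ℝ) (hw : ∀ i, Continuous (w i))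
    (B : ℝ) (haB : a ≤ B) (hB : ∀ i, ∀ t, 0 ≤ t → t ≤ a → w i t ≤ B) :
    IsCompact (T5 k a w) := by
  have hc : IsCompact ((EuclideanSpace.equiv (Fin (k+1)) ℝ).toHomeomorph ⁻¹'
      (Set.pi univ fun _ => Icc (0:ℝ) B)) := by
    rw [Homeomorph.isCompact_preimage]
    exact isCompact_univ_pi fun _ => isCompact_Icc
  refine hc.of_isClosed_subset (T5_closed k a w hw) ?_
  rintro x ⟨⟨h0, h1⟩, h⟩ i -
  change 0 ≤ x i ∧ x i ≤ B
  refine Fin.cases ⟨h0, h1.trans haB⟩ (fun j => ⟨(h j).1, (h j).2.trans (hB j _ h0 h1)⟩) i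

theorem T5_convex (k : ℕ) (a : ℝ) (w : Fin k → ℝ → ℝ) (hw : ∀ i, ConcaveOn ℝ univ (w i)) :
    Convex ℝ (T5 k a w) := by
  rintro x ⟨⟨hx0, hx1⟩, hx⟩ y ⟨⟨hy0, hy1⟩, hy⟩ p q hp hq hpq
  refine ⟨⟨?_, ?_⟩, fun i => ⟨?_, ?_⟩⟩
  · change 0 ≤ p * x 0 + q * y 0
    positivity
  · change p * x 0 + q * y 0 ≤ a
    have : a = p * a + q * a := by rw [← add_mul, hpq, one_mul]
    rw [this]; gcongr
  · change 0 ≤ p * x i.succ + q * y i.succ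
    have := (hx i).1
    have := (hy i).1
    positivity
  · change p * x i.succ + q * y i.succ ≤ w i (p * x 0 + q * y 0)
    refine le_trans ?_ ((hw i).2 (mem_univ _) (mem_univ _) hp hq hpq)
    have := (hx i).2
    have := (hy i).2
    simp only [smul_eq_mul]
    gcongr

theorem T5_volume (k : ℕ) (a : ℝ) (ha : 0 ≤ a) (w : Fin k → ℝ → ℝ) (hw : ∀ i, Continuous (w i))
    (hpos : ∀ i, ∀ t, 0 ≤ t → t ≤ a → 0 ≤ w i t) :
    volume (T5 k a w) = ENNReal.ofReal (∫ t in (0:ℝ)..a, ∏ i, w i t) := by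
  have hm : MeasurableSet (T5 k a w) := (T5_closed k a w hw).measurableSet
  let S : Set (ℝ × (Fin k → ℝ)) :=
    {p | (0 ≤ p.1 ∧ p.1 ≤ a) ∧ ∀ i : Fin k, 0 ≤ p.2 i ∧ p.2 i ≤ w i p.1}
  have hS : MeasurableSet S := by
    simp only [S, ofPred_and, ofPred_forall]
    refine ((isClosed_le (by fun_prop) (by fun_prop)).inter
      (isClosed_le (by fun_prop) (by fun_prop))).inter
      (isClosed_iInter fun i => IsClosed.inter ?_ ?_) |>.measurableSet
    · exact isClosed_le (by fun_prop) (by fun_prop)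
    · exact isClosed_le (by fun_prop) ((hw i).comp (by fun_prop))
  have h1 : volume (T5 k a w) = volume S := by
    have e1 := EuclideanSpace.volume_preserving_symm_measurableEquiv_toLp (Fin (k+1))
    have e2 := volume_preserving_piFinSuccAbove (fun _ : Fin (k+1) => ℝ) 0
    have e := e2.comp e1
    rw [← e.measure_preimage hS.nullMeasurableSet]
    congr 1
  rw [h1, Measure.volume_eq_prod, Measure.prod_apply hS]
  have h2 : ∀ t, volume (Prod.mk t ⁻¹' S) =
      (Icc 0 a).indicator (fun t => ENNReal.ofReal (∏ i, w i t)) t := by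
    intro t
    by_cases ht : t ∈ Icc 0 a
    · rw [indicator_of_mem ht]
      have : Prod.mk t ⁻¹' S = Set.pi univ fun i => Icc 0 (w i t) := by
        ext y
        simp only [S, mem_preimage, mem_ofPred_eq, Set.mem_pi, mem_univ, true_imp_iff, mem_Icc]
        exact ⟨fun h => h.2, fun h => ⟨ht, h⟩⟩
      rw [this, volume_pi_pi, ENNReal.ofReal_prod_of_nonneg fun i _ => hpos i t ht.1 ht.2]
      simp
    · rw [indicator_of_notMem ht]
      have : Prod.mk t ⁻¹' S = ∅ := by
        ext y
        simp only [S, mem_preimage, mem_ofPred_eq, mem_empty_iff_false, iff_false]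
        exact fun h => ht h.1
      rw [this, measure_empty]
  simp_rw [h2]
  rw [lintegral_indicator measurableSet_Icc, intervalIntegral.integral_of_le ha,
    ← integral_Icc_eq_integral_Ioc, ofReal_integral_eq_lintegral_ofReal]
  · exact (continuous_finsetProd _ fun i _ => hw i).continuousOn.integrableOn_compact isCompact_Icc
  · filter_upwards [ae_restrict_mem measurableSet_Icc] with t ht
    exact Finset.prod_nonneg fun i _ => hpos i t ht.1 ht.2

theorem T5_haus (k : ℕ) : ∃ C : ℝ, 0 < C ∧ ∀ S : Set (EuclideanSpace ℝ (Fin k)),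
    μH[(k : ℝ)] S = ENNReal.ofReal C * volume S := by
  have : Measure.IsAddHaarMeasure (μH[(k : ℝ)] : Measure (EuclideanSpace ℝ (Fin k))) := by
    simpa using MeasureTheory.isAddHaarMeasure_hausdorffMeasure (E := EuclideanSpace ℝ (Fin k))
  have h := Measure.isAddLeftInvariant_eq_smul (μH[(k : ℝ)] : Measure (EuclideanSpace ℝ (Fin k)))
    volume
  refine ⟨NNReal.toReal (Measure.addHaarScalarFactor
      (μH[(k : ℝ)] : Measure (EuclideanSpace ℝ (Fin k))) volume), ?_, fun S => ?_⟩
  · exact_mod_cast Measure.addHaarScalarFactor_pos_of_isAddHaarMeasure _ _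
  · conv_lhs => rw [h]
    rw [Measure.smul_apply, ENNReal.ofReal_coe_nnreal]
    rfl

theorem T5_interior (k : ℕ) (a : ℝ) (w : Fin k → ℝ → ℝ) (hw : ∀ i, Continuous (w i))
    (hc : ∀ i, ConcaveOn ℝ univ (w i)) (hv : volume (T5 k a w) ≠ 0) :
    (interior (T5 k a w)).Nonempty := by
  by_contra h
  rw [not_nonempty_iff_eq_empty] at h
  have := (T5_convex k a w hc).addHaar_frontier volume
  rw [frontier, h, sdiff_empty, (T5_closed k a w hw).closure_eq] at this
  exact hv this

/-- Insert a zero coordinate at index one. -/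
def ins5 (k : ℕ) (y : EuclideanSpace ℝ (Fin (k + 1))) : EuclideanSpace ℝ (Fin (k + 2)) :=
  WithLp.toLp 2 (Fin.cons (y 0) (Fin.cons 0 fun i : Fin k => y i.succ))

theorem ins5_isometry (k : ℕ) : Isometry (ins5 k) := by
  refine Isometry.of_dist_eq fun x y => ?_
  rw [EuclideanSpace.dist_eq, EuclideanSpace.dist_eq]
  simp [Fin.sum_univ_succ, ins5]

/-- The direction. -/
def u5 (k : ℕ) : EuclideanSpace ℝ (Fin (k + 2)) := EuclideanSpace.single 1 1

theorem proj5 (k : ℕ) (a : ℝ) (f : ℝ → ℝ) (w : Fin k → ℝ → ℝ)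
    (hf : ∀ t, 0 ≤ t → t ≤ a → 0 ≤ f t) :
    projPerp (u5 k) (T5 (k + 1) a (Fin.cons f w)) = ins5 k '' T5 k a w := by
  have key : ∀ x : EuclideanSpace ℝ (Fin (k + 2)), x - ⟪x, u5 k⟫ • u5 k =
      ins5 k (WithLp.toLp 2 (Fin.cons (x 0) fun i : Fin k => x i.succ.succ)) := by
    intro x
    ext i
    refine Fin.cases ?_ (fun i => Fin.cases ?_ (fun i => ?_) i) i
    · simp [u5, ins5]
    · simp [u5, ins5, EuclideanSpace.inner_single_right]
    · have : (i.succ.succ : Fin (k+2)) ≠ 1 := by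
        rw [← Fin.succ_zero_eq_one]
        exact fun h => Fin.succ_ne_zero _ (Fin.succ_injective _ h)
      simp [u5, ins5, this]
  apply Subset.antisymm
  · rintro _ ⟨x, ⟨h0, h⟩, rfl⟩
    refine ⟨_, ⟨?_, fun i => ?_⟩, (key x).symm⟩
    · simpa using h0
    · simpa using h i.succ
  · rintro _ ⟨y, ⟨h0, h⟩, rfl⟩
    refine ⟨ins5 k y, ⟨by simpa [ins5] using h0, fun i => ?_⟩, ?_⟩
    · refine Fin.cases ?_ (fun i => ?_) i
      · simpa [ins5] using hf _ h0.1 h0.2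
      · simpa [ins5] using h i
    · change _ - _ = _
      rw [key]
      congr 1
      ext i
      refine Fin.cases ?_ (fun i => ?_) i <;> simp [ins5]

/-- Side functions. -/
def w5 (m : ℕ) (g : ℝ → ℝ) (c : ℝ) : Fin (m + 1) → ℝ → ℝ := Fin.cons g fun _ _ => c

theorem w5_prod (m : ℕ) (g : ℝ → ℝ) (c t : ℝ) : ∏ i, w5 m g c i t = g t * c ^ m := by
  simp [w5, Fin.prod_univ_succ]

theorem w5_prod' (m : ℕ) (f g : ℝ → ℝ) (c t : ℝ) :
    ∏ i, (Fin.cons f (w5 m g c) : Fin (m + 2) → ℝ → ℝ) i t = f t * (g t * c ^ m) := by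
  rw [Fin.prod_univ_succ, ← w5_prod]
  simp

theorem w5_all (m : ℕ) (g : ℝ → ℝ) (c : ℝ) (P : (ℝ → ℝ) → Prop) (hg : P g)
    (hc : P fun _ => c) (i : Fin (m + 1)) : P (w5 m g c i) := by
  refine Fin.cases ?_ (fun i => ?_) i
  · simpa [w5] using hg
  · simpa [w5] using hc

theorem w5_all' (m : ℕ) (f g : ℝ → ℝ) (c : ℝ) (P : (ℝ → ℝ) → Prop) (hf : P f) (hg : P g)
    (hc : P fun _ => c) (i : Fin (m + 2)) :
    P ((Fin.cons f (w5 m g c) : Fin (m + 2) → ℝ → ℝ) i) := by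
  refine Fin.cases ?_ (fun i => ?_) i
  · simpa using hf
  · simpa using w5_all m g c P hg hc i

theorem conc5 : ConcaveOn ℝ univ (fun t : ℝ => 1 - t) := by
  refine ⟨convex_univ, fun x _ y _ p q _ _ h => ?_⟩
  simp only [smul_eq_mul]
  nlinarith

/-- First body. -/
def K5 (m : ℕ) : Set (EuclideanSpace ℝ (Fin (m + 3))) :=
  T5 (m + 2) 1 (Fin.cons (fun t => 1 - t) (w5 m (fun t => 1 - t) 1))

/-- Second body. -/
def L5 (m : ℕ) : Set (EuclideanSpace ℝ (Fin (m + 3))) :=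
  T5 (m + 2) (1 / 40) (Fin.cons (fun _ => 1) (w5 m (fun _ => 20) 1))

theorem sum_sub (m : ℕ) : K5 m + L5 m ⊆
    T5 (m + 2) (41 / 40) (Fin.cons (fun t => 81 / 40 - t) (w5 m (fun _ => 21) 2)) := by
  rintro _ ⟨x, ⟨hx0, hx⟩, y, ⟨hy0, hy⟩, rfl⟩
  simp only [Fin.forall_fin_succ, w5, Fin.cons_zero, Fin.cons_succ] at hx hy
  refine ⟨?_, ?_⟩
  · simp only [PiLp.add_apply]
    constructor <;> linarith
  · simp only [Fin.forall_fin_succ, w5, Fin.cons_zero, Fin.cons_succ, PiLp.add_apply]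
    refine ⟨⟨?_, ?_⟩, ⟨?_, ?_⟩, fun i => ⟨?_, ?_⟩⟩
    · linarith
    · linarith
    · linarith
    · linarith
    · linarith [(hx.2.2 i).1, (hy.2.2 i).1]
    · linarith [(hx.2.2 i).2, (hy.2.2 i).2]

theorem sub_sum (m : ℕ) : T5 (m + 2) (41 / 40) (Fin.cons (fun _ => 1) (w5 m (fun _ => 20) 2)) ⊆
    K5 m + L5 m := by
  rintro z ⟨hz0, hz⟩
  simp only [Fin.forall_fin_succ, w5, Fin.cons_zero, Fin.cons_succ] at hz
  let x : EuclideanSpace ℝ (Fin (m + 3)) := WithLp.toLp 2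
    (Fin.cons (min (z 0) 1) (Fin.cons 0 (Fin.cons 0 fun i : Fin m => min (z i.succ.succ.succ) 1)))
  refine ⟨x, ⟨?_, ?_⟩, z - x, ⟨?_, ?_⟩, by simp⟩
  · simp only [x, Fin.cons_zero]
    exact ⟨le_min hz0.1 zero_le_one, min_le_right _ _⟩
  · simp only [Fin.forall_fin_succ, w5, Fin.cons_zero, Fin.cons_succ, x]
    refine ⟨⟨le_rfl, by simp⟩, ⟨le_rfl, by simp⟩, fun i => ⟨le_min (hz.2.2 i).1 zero_le_one, min_le_right _ _⟩⟩
  · simp only [x, Fin.cons_zero, PiLp.sub_apply]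
    rcases min_cases (z 0) 1 with h | h <;> constructor <;> linarith
  · simp only [Fin.forall_fin_succ, w5, Fin.cons_zero, Fin.cons_succ, x, PiLp.sub_apply, sub_zero]
    refine ⟨hz.1, hz.2.1, fun i => ?_⟩
    have := hz.2.2 i
    rcases min_cases (z i.succ.succ.succ) 1 with h | h <;> constructor <;> linarith

theorem stmt5 (n : ℕ) (hn : 3 ≤ n) :
    ∃ (K L : Set (EuclideanSpace ℝ (Fin n))) (u : EuclideanSpace ℝ (Fin n)),
      IsCompact K ∧ Convex ℝ K ∧ (interior K).Nonempty ∧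
      IsCompact L ∧ Convex ℝ L ∧ (interior L).Nonempty ∧
      ‖u‖ = 1 ∧
      μH[(n : ℝ) - 1] (projPerp u K) = μH[(n : ℝ) - 1] (projPerp u L) ∧
      μH[(n : ℝ) - 1] (projPerp u K) ≠ 0 ∧
      μH[(n : ℝ)] (K + L) / μH[(n : ℝ) - 1] (projPerp u (K + L)) <
        μH[(n : ℝ)] K / μH[(n : ℝ) - 1] (projPerp u K) +
          μH[(n : ℝ)] L / μH[(n : ℝ) - 1] (projPerp u L) := by
  obtain ⟨m, rfl⟩ : ∃ m, n = m + 3 := ⟨n - 3, by omega⟩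
  have hcast : (((m + 3 : ℕ) : ℝ) - 1) = ((m + 2 : ℕ) : ℝ) := by push_cast; ring
  rw [hcast]
  obtain ⟨C, hC, hCv⟩ := T5_haus (m + 3)
  obtain ⟨D, hD, hDv⟩ := T5_haus (m + 2)
  have hproj : ∀ (a : ℝ) (f : ℝ → ℝ) (w : Fin (m + 1) → ℝ → ℝ),
      (∀ t, 0 ≤ t → t ≤ a → 0 ≤ f t) →
      μH[((m + 2 : ℕ) : ℝ)] (projPerp (u5 (m + 1)) (T5 (m + 2) a (Fin.cons f w))) =
        ENNReal.ofReal D * volume (T5 (m + 1) a w) := by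
    intro a f w hf
    rw [proj5 (m + 1) a f w hf, (ins5_isometry (m + 1)).hausdorffMeasure_image (Or.inl (by positivity)),
      hDv]
  have c1 : Continuous fun t : ℝ => 1 - t := by fun_prop
  have cc : ∀ c : ℝ, Continuous fun _ : ℝ => c := fun c => continuous_const
  have kc : ∀ c : ℝ, ConcaveOn ℝ univ fun _ : ℝ => c := fun c => concaveOn_const c convex_univ
  have hKc := w5_all' m (fun t => 1 - t) (fun t => 1 - t) 1 Continuous c1 c1 (cc 1)
  have hLc := w5_all' m (fun _ => 1) (fun _ => 20) 1 Continuous (cc _) (cc _) (cc 1)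
  have hKk := w5_all' m (fun t => 1 - t) (fun t => 1 - t) 1 (ConcaveOn ℝ univ) conc5 conc5 (kc 1)
  have hLk := w5_all' m (fun _ => 1) (fun _ => 20) 1 (ConcaveOn ℝ univ) (kc _) (kc _) (kc 1)
  have vK : volume (K5 m) = ENNReal.ofReal (1 / 3) := by
    rw [K5, T5_volume _ _ zero_le_one _ hKc]
    · congr 1
      simp_rw [w5_prod']
      have : ∀ t : ℝ, (1 - t) * ((1 - t) * 1 ^ m) = (1 - t) ^ 2 := by intro t; ring
      simp_rw [this]
      rw [intervalIntegral.integral_comp_sub_left (fun t => t ^ 2) (1:ℝ)]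
      simp; try norm_num
    · exact w5_all' m _ _ _ (fun g => ∀ t, 0 ≤ t → t ≤ 1 → 0 ≤ g t) (fun t _ h => by linarith)
        (fun t _ h => by linarith) (fun t _ h => by norm_num)
  have vL : volume (L5 m) = ENNReal.ofReal (1 / 2) := by
    rw [L5, T5_volume _ _ (by norm_num) _ hLc]
    · congr 1
      simp_rw [w5_prod']
      simp; try norm_num
    · exact w5_all' m _ _ _ (fun g => ∀ t, 0 ≤ t → t ≤ 1/40 → 0 ≤ g t) (fun t _ h => by norm_num)
        (fun t _ h => by norm_num) (fun t _ h => by norm_num)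
  have vS : volume (T5 (m + 2) (41 / 40)
      (Fin.cons (fun t => 81 / 40 - t) (w5 m (fun _ => 21) 2))) =
      ENNReal.ofReal (21 * (41 / 40 + (41 / 40) ^ 2 / 2) * 2 ^ m) := by
    rw [T5_volume _ _ (by norm_num)]
    · congr 1
      simp_rw [w5_prod']
      rw [intervalIntegral.integral_mul_const, intervalIntegral.integral_sub (by simp) (by simp)]
      simp; ring
    · exact w5_all' m _ _ _ Continuous (by fun_prop) (cc _) (cc _)
    · exact w5_all' m _ _ _ (fun g => ∀ t, 0 ≤ t → t ≤ 41/40 → 0 ≤ g t) (fun t _ h => by linarith)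
        (fun t _ h => by norm_num) (fun t _ h => by norm_num)
  have pK : μH[((m + 2 : ℕ) : ℝ)] (projPerp (u5 (m + 1)) (K5 m)) =
      ENNReal.ofReal (D * (1 / 2)) := by
    rw [K5, hproj _ _ _ (fun t _ h => by linarith), T5_volume _ _ zero_le_one,
      ← ENNReal.ofReal_mul hD.le]
    · congr 2
      simp_rw [w5_prod]
      rw [intervalIntegral.integral_mul_const,
        intervalIntegral.integral_comp_sub_left (fun t => t) (1:ℝ)]
      simp
    · exact w5_all m _ _ Continuous c1 (cc _)
    · exact w5_all m _ _ (fun g => ∀ t, 0 ≤ t → t ≤ 1 → 0 ≤ g t)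
        (fun t _ h => by linarith) (fun t _ h => by norm_num)
  have pL : μH[((m + 2 : ℕ) : ℝ)] (projPerp (u5 (m + 1)) (L5 m)) =
      ENNReal.ofReal (D * (1 / 2)) := by
    rw [L5, hproj _ _ _ (fun t _ h => by norm_num), T5_volume _ _ (by norm_num),
      ← ENNReal.ofReal_mul hD.le]
    · congr 2
      simp_rw [w5_prod]
      simp; try norm_num
    · exact w5_all m _ _ Continuous (cc _) (cc _)
    · exact w5_all m _ _ (fun g => ∀ t, 0 ≤ t → t ≤ 1/40 → 0 ≤ g t)
        (fun t _ h => by norm_num) (fun t _ h => by norm_num)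
  have pS : ENNReal.ofReal (D * (41 / 40 * 20 * 2 ^ m)) ≤
      μH[((m + 2 : ℕ) : ℝ)] (projPerp (u5 (m + 1)) (K5 m + L5 m)) := by
    refine le_trans (le_of_eq ?_) (measure_mono (image_mono (sub_sum m)))
    change _ = μH[((m + 2 : ℕ) : ℝ)] (projPerp (u5 (m + 1)) _)
    rw [hproj _ _ _ (fun t _ h => by norm_num), T5_volume _ _ (by norm_num),
      ← ENNReal.ofReal_mul hD.le]
    · congr 2
      simp_rw [w5_prod]
      simp; ring
    · exact w5_all m _ _ Continuous (cc _) (cc _)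
    · exact w5_all m _ _ (fun g => ∀ t, 0 ≤ t → t ≤ 41/40 → 0 ≤ g t)
        (fun t _ h => by norm_num) (fun t _ h => by norm_num)
  refine ⟨K5 m, L5 m, u5 (m + 1), ?_, T5_convex _ _ _ hKk, ?_, ?_, T5_convex _ _ _ hLk, ?_, ?_,
    pK.trans pL.symm, ?_, ?_⟩
  · exact T5_compact _ _ _ hKc 1 le_rfl (w5_all' m _ _ _ (fun g => ∀ t, 0 ≤ t → t ≤ 1 → g t ≤ 1)
      (fun t h _ => by linarith) (fun t h _ => by linarith) (fun t _ h => le_rfl))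
  · exact T5_interior _ _ _ hKc hKk (by change volume (K5 m) ≠ 0; rw [vK]; simp)
  · exact T5_compact _ _ _ hLc 20 (by norm_num)
      (w5_all' m _ _ _ (fun g => ∀ t, 0 ≤ t → t ≤ 1/40 → g t ≤ 20)
      (fun t h _ => by norm_num) (fun t h _ => by norm_num) (fun t _ h => by norm_num))
  · exact T5_interior _ _ _ hLc hLk (by change volume (L5 m) ≠ 0; rw [vL]; simp)
  · simp [u5]
  · rw [pK]
    simpa using hD
  · rw [pK, pL, hCv (K5 m), hCv (L5 m), vK, vL, ← ENNReal.ofReal_mul hC.le,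
      ← ENNReal.ofReal_mul hC.le, ← ENNReal.ofReal_div_of_pos (by positivity),
      ← ENNReal.ofReal_div_of_pos (by positivity),
      ← ENNReal.ofReal_add (by positivity) (by positivity)]
    have vS' : μH[((m + 3 : ℕ) : ℝ)] (K5 m + L5 m) ≤
        ENNReal.ofReal (C * (21 * (41 / 40 + (41 / 40) ^ 2 / 2) * 2 ^ m)) := by
      rw [hCv, ENNReal.ofReal_mul hC.le, ← vS]
      gcongr
      exact sum_sub m
    refine lt_of_le_of_lt (ENNReal.div_le_div vS' pS) ?_
    rw [← ENNReal.ofReal_div_of_pos (by positivity), ENNReal.ofReal_lt_ofReal_iff (by positivity)]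
    have e1 : C * (21 * (41 / 40 + (41 / 40) ^ 2 / 2) * 2 ^ m) / (D * (41 / 40 * 20 * 2 ^ m)) =
        (C / D) * (21 * (41 / 40 + (41 / 40) ^ 2 / 2) / (41 / 40 * 20)) := by
      field_simp
    have e2 : C * (1 / 3) / (D * (1 / 2)) + C * (1 / 2) / (D * (1 / 2)) = (C / D) * (5 / 3) := by
      field_simp
      norm_num
    rw [e1, e2]
    have : 0 < C / D := by positivity
    exact mul_lt_mul_of_pos_left (by norm_num) this
end
end

section
/- For every integer n ≥ 2 and every real 0 < ε < 1, there exists an n-dimensional convex body C ⊂ R^n such that its Cheeger set C(C) satisfies H^n(C(C))/H^{n-1}(∂C(C)) > (1-ε)·n·H^n(C)/H^{n-1}(∂C). Concretely, the simplex C = conv{0, h²e_1, ..., h²e_{n-1}, e_n} works for h sufficiently large. -/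
open MeasureTheory Set Pointwise Filter
open scoped ENNReal RealInnerProductSpace

noncomputable section

theorem haus_eq (m : ℕ) : ∃ c : ℝ, 0 < c ∧ ∀ s : Set (Fin m → ℝ), MeasurableSet s →
    μH[(m : ℝ)] {x : EuclideanSpace ℝ (Fin m) | x.ofLp ∈ s} = ENNReal.ofReal c * volume s := by
  have hH : Measure.IsAddHaarMeasure (μH[(m : ℝ)] : Measure (EuclideanSpace ℝ (Fin m))) := by
    simpa using MeasureTheory.isAddHaarMeasure_hausdorffMeasure (E := EuclideanSpace ℝ (Fin m))
  have h := Measure.isAddLeftInvariant_eq_smul (μH[(m : ℝ)] : Measure (EuclideanSpace ℝ (Fin m)))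
    volume
  refine ⟨Measure.addHaarScalarFactor (μH[(m : ℝ)] : Measure (EuclideanSpace ℝ (Fin m)))
    volume, ?_, ?_⟩
  · exact_mod_cast Measure.addHaarScalarFactor_pos_of_isAddHaarMeasure _ _
  · intro s hs
    rw [← (PiLp.volume_preserving_ofLp (Fin m)).measure_preimage hs.nullMeasurableSet]
    conv_lhs => rw [h]
    rw [Measure.smul_apply, ENNReal.ofReal_coe_nnreal]
    rfl

def pyr (m : ℕ) (h : ℝ) : Set (Fin (m + 1) → ℝ) :=
  {f | 0 ≤ f 0 ∧ ∀ j : Fin m, 0 ≤ f j.succ ∧ f j.succ + f 0 / h ≤ 1}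

theorem pyr_closed (m : ℕ) (h : ℝ) : IsClosed (pyr m h) := by
  have : pyr m h = {f | 0 ≤ f 0} ∩ ⋂ j : Fin m, ({f | 0 ≤ f j.succ} ∩ {f | f j.succ + f 0 / h ≤ 1}) := by
    ext f; simp [pyr]
  rw [this]
  refine (isClosed_le (by fun_prop) (by fun_prop)).inter (isClosed_iInter fun j => ?_)
  exact (isClosed_le (by fun_prop) (by fun_prop)).inter (isClosed_le (by fun_prop) (by fun_prop))

theorem pyr_vol (k : ℕ) (h : ℝ) (hh : 0 < h) :
    volume (pyr (k + 1) h) ≤ ENNReal.ofReal (h / (k + 2)) := by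
  have hp := (volume_preserving_piFinSuccAbove (fun _ : Fin (k + 2) => ℝ) 0).symm
  rw [← hp.measure_preimage (pyr_closed _ h).measurableSet.nullMeasurableSet]
  rw [Measure.volume_eq_prod, Measure.prod_apply]
  swap
  · exact hp.measurable (pyr_closed _ h).measurableSet
  calc _ ≤ ∫⁻ t in Icc 0 h, ENNReal.ofReal ((1 - t / h) ^ (k + 1)) := by
        rw [← lintegral_indicator measurableSet_Icc]
        refine lintegral_mono fun t => ?_
        by_cases ht : t ∈ Icc 0 h
        · rw [indicator_of_mem ht]
          have : (Prod.mk t ⁻¹' ((MeasurableEquiv.piFinSuccAbove (fun _ : Fin (k + 2) => ℝ) 0).symm ⁻¹'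
              pyr (k + 1) h)) ⊆ Icc (0 : Fin (k + 1) → ℝ) (fun _ => 1 - t / h) := by
            intro y hy
            simp [pyr, MeasurableEquiv.piFinSuccAbove] at hy
            refine ⟨fun j => (hy.2 j).1, fun j => ?_⟩
            have := (hy.2 j).2
            dsimp only
            linarith
          refine (measure_mono this).trans ?_
          rw [Real.volume_Icc_pi]
          have h1 : 0 ≤ 1 - t / h := by
            rw [sub_nonneg, div_le_one hh]; exact ht.2
          simp [ENNReal.ofReal_pow h1]
        · rw [indicator_of_notMem ht]
          refine le_of_eq ?_
          convert measure_empty (μ := volume)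
          rw [eq_empty_iff_forall_notMem]
          intro y hy
          simp [pyr, MeasurableEquiv.piFinSuccAbove] at hy
          refine ht ⟨hy.1, ?_⟩
          have := hy.2 0
          rw [← div_le_one hh]
          linarith
    _ = ENNReal.ofReal (∫ t in Icc 0 h, (1 - t / h) ^ (k + 1)) := by
        rw [ofReal_integral_eq_lintegral_ofReal]
        · exact (Continuous.continuousOn (by fun_prop)).integrableOn_Icc
        · filter_upwards [ae_restrict_mem measurableSet_Icc] with t ht
          have h1 : 0 ≤ 1 - t / h := by
            rw [sub_nonneg, div_le_one hh]; exact ht.2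
          exact pow_nonneg h1 _
    _ ≤ _ := by
        apply ENNReal.ofReal_le_ofReal
        rw [integral_Icc_eq_integral_Ioc, ← intervalIntegral.integral_of_le hh.le]
        have := intervalIntegral.integral_comp_sub_div (fun x => x ^ (k + 1)) (a := 0) (b := h) hh.ne' 1
        rw [this]
        simp [integral_pow, hh.ne']
        apply le_of_eq
        field_simp
        ring

def ins {m : ℕ} (i : Fin (m + 1)) (t : ℝ) (y : EuclideanSpace ℝ (Fin m)) :
    EuclideanSpace ℝ (Fin (m + 1)) := WithLp.toLp 2 (i.insertNth t y.ofLp : Fin (m + 1) → ℝ)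

def prj {m : ℕ} (i : Fin (m + 1)) (x : EuclideanSpace ℝ (Fin (m + 1))) :
    EuclideanSpace ℝ (Fin m) := WithLp.toLp 2 (fun j => x (i.succAbove j))

theorem ins_isometry {m : ℕ} (i : Fin (m + 1)) (t : ℝ) : Isometry (ins i t) := by
  refine Isometry.of_dist_eq fun x y => ?_
  rw [EuclideanSpace.dist_eq, EuclideanSpace.dist_eq, Fin.sum_univ_succAbove _ i]
  simp [ins]

theorem prj_lip {m : ℕ} (i : Fin (m + 1)) : LipschitzWith 1 (prj i) := by
  refine LipschitzWith.of_dist_le_mul fun x y => ?_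
  rw [EuclideanSpace.dist_eq, EuclideanSpace.dist_eq, Fin.sum_univ_succAbove _ i]
  simp only [NNReal.coe_one, one_mul, prj]
  apply Real.sqrt_le_sqrt
  have := sq_nonneg (dist (x i) (y i))
  linarith

/-- points from which one exits a set along coordinate zero are frontier points -/
theorem mem_frontier_of_exit {m : ℕ} {S : Set (EuclideanSpace ℝ (Fin (m + 1)))}
    {x : EuclideanSpace ℝ (Fin (m + 1))} (hx : x ∈ S) (σ : ℝ)
    (h : ∀ s : ℝ, 0 < s → x + (s * σ) • EuclideanSpace.single 0 1 ∉ S) : x ∈ frontier S := by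
  refine ⟨subset_closure hx, fun hi => ?_⟩
  have hc : Continuous (fun s : ℝ => x + (s * σ) • (EuclideanSpace.single 0 1 :
    EuclideanSpace ℝ (Fin (m + 1)))) := by fun_prop
  have h0 : (fun s : ℝ => x + (s * σ) • (EuclideanSpace.single 0 1 :
    EuclideanSpace ℝ (Fin (m + 1)))) ⁻¹' S ∈ nhds (0 : ℝ) := by
    apply hc.continuousAt.preimage_mem_nhds
    simpa using mem_interior_iff_mem_nhds.1 hi
  have h1 := nhdsWithin_le_nhds (s := Ioi 0) h0
  have h2 : Ioi (0 : ℝ) ∈ nhdsWithin (0 : ℝ) (Ioi 0) := self_mem_nhdsWithin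
  obtain ⟨s, hs1, hs2⟩ := Filter.nonempty_of_mem (Filter.inter_mem h1 h2)
  exact h s hs2 hs1

def body {m : ℕ} (s : Set (Fin m → ℝ)) : Set (EuclideanSpace ℝ (Fin m)) := {x | x.ofLp ∈ s}

theorem body_closed {m : ℕ} {s : Set (Fin m → ℝ)} (hs : IsClosed s) : IsClosed (body s) :=
  hs.preimage (PiLp.continuous_ofLp 2 _)

theorem body_compact {m : ℕ} {s : Set (Fin m → ℝ)} (hs : IsCompact s) : IsCompact (body s) :=
  (EuclideanSpace.equiv (Fin m) ℝ).toHomeomorph.isCompact_preimage.2 hs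

theorem ins_face_le {m : ℕ} {c : ℝ} (hc : ∀ s : Set (Fin m → ℝ), MeasurableSet s →
    μH[(m : ℝ)] (body s) = ENNReal.ofReal c * volume s) (a : Fin (m + 1) → ℝ)
    (i : Fin (m + 1)) (t : ℝ) :
    μH[(m : ℝ)] {x : EuclideanSpace ℝ (Fin (m + 1)) | x ∈ body (Icc 0 a) ∧ x i = t} ≤
      ENNReal.ofReal c * ∏ j, ENNReal.ofReal (a (i.succAbove j)) := by
  have hsub : {x : EuclideanSpace ℝ (Fin (m + 1)) | x ∈ body (Icc 0 a) ∧ x i = t} ⊆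
      ins i t '' body (Icc 0 (fun j => a (i.succAbove j))) := by
    rintro x ⟨hx, rfl⟩
    refine ⟨prj i x, ⟨fun j => hx.1 _, fun j => hx.2 _⟩, ?_⟩
    ext j
    rcases Fin.eq_self_or_eq_succAbove i j with rfl | ⟨j, rfl⟩ <;> simp [ins, prj]
  refine (measure_mono hsub).trans ?_
  rw [(ins_isometry i t).hausdorffMeasure_image (Or.inl (Nat.cast_nonneg m)),
    hc _ measurableSet_Icc, Real.volume_Icc_pi]
  simp

theorem base_le {m : ℕ} {c : ℝ} (hc : ∀ s : Set (Fin m → ℝ), MeasurableSet s →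
    μH[(m : ℝ)] (body s) = ENNReal.ofReal c * volume s) (S : Set (Fin (m + 1) → ℝ))
    (hS : ∀ f ∈ S, 0 ≤ f 0) (b : Fin m → ℝ)
    (hb : ∀ y ∈ Icc 0 b, (Fin.insertNth 0 (0 : ℝ) y : Fin (m + 1) → ℝ) ∈ S) :
    ENNReal.ofReal c * ∏ j, ENNReal.ofReal (b j) ≤
      μH[(m : ℝ)] (frontier (body S) ∩ {x | x 0 ≤ 0}) := by
  have hsub : ins 0 0 '' body (Icc 0 b) ⊆ frontier (body S) ∩ {x | x 0 ≤ 0} := by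
    rintro _ ⟨y, hy, rfl⟩
    refine ⟨mem_frontier_of_exit (hb _ hy) (-1) fun s hs hx => ?_, by simp [ins]⟩
    have := hS _ hx
    simp [ins] at this
    linarith
  refine le_trans ?_ (measure_mono hsub)
  rw [(ins_isometry 0 0).hausdorffMeasure_image (Or.inl (Nat.cast_nonneg m)),
    hc _ measurableSet_Icc, Real.volume_Icc_pi]
  simp

theorem lid_le {k : ℕ} {c : ℝ} (hc : ∀ s : Set (Fin (k + 1) → ℝ), MeasurableSet s →
    μH[((k + 1 : ℕ) : ℝ)] (body s) = ENNReal.ofReal c * volume s) (h : ℝ) (hh : 0 < h) :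
    ENNReal.ofReal c ≤
      μH[((k + 1 : ℕ) : ℝ)] (frontier (body (pyr (k + 1) h)) \ {x | x 0 ≤ 0}) := by
  have hsub : body (pi univ fun _ : Fin (k + 1) => Ioo (0 : ℝ) 1) ⊆
      prj 0 '' (frontier (body (pyr (k + 1) h)) \ {x | x 0 ≤ 0}) := by
    intro y hy
    have hy' : ∀ j, y j ∈ Ioo (0 : ℝ) 1 := fun j => hy j (mem_univ j)
    obtain ⟨j0, hj0⟩ := Finite.exists_max (fun j => y j)
    have hpos : 0 < h * (1 - y j0) := mul_pos hh (by linarith [(hy' j0).2])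
    have hdiv : h * (1 - y j0) / h = 1 - y j0 := by field_simp
    refine ⟨ins 0 (h * (1 - y j0)) y, ⟨mem_frontier_of_exit ?_ 1 ?_, ?_⟩, ?_⟩
    · refine ⟨by simpa [ins] using hpos.le, fun j => ⟨?_, ?_⟩⟩
      · simpa [ins] using (hy' j).1.le
      · simp only [ins, Fin.insertNth_zero', Fin.cons_succ, Fin.cons_zero, hdiv]
        linarith [hj0 j]
    · intro s hs hx
      have := (hx.2 j0).2
      simp [ins, add_div, hdiv] at this
      have : 0 < s / h := by positivity
      linarith
    · simpa [ins] using hpos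
    · ext j; simp [prj, ins]
  calc ENNReal.ofReal c = μH[((k + 1 : ℕ) : ℝ)] (body (pi univ fun _ : Fin (k + 1) => Ioo (0 : ℝ) 1)) := by
        rw [hc _ (MeasurableSet.univ_pi fun _ => measurableSet_Ioo), Real.volume_pi_Ioo]
        simp
    _ ≤ _ := measure_mono hsub
    _ ≤ _ := (prj_lip 0).hausdorffMeasure_image_le (Nat.cast_nonneg _) _
    _ = _ := by simp

theorem frontier_box {m : ℕ} (a : Fin (m + 1) → ℝ) :
    frontier (body (Icc 0 a)) ⊆ ⋃ i : Fin (m + 1), ({x | x ∈ body (Icc 0 a) ∧ x i = 0} ∪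
      {x | x ∈ body (Icc 0 a) ∧ x i = a i}) := by
  intro x hx
  have hxB : x ∈ body (Icc 0 a) := (body_closed isClosed_Icc).frontier_subset hx
  by_contra hcon
  simp only [mem_iUnion, mem_union, mem_ofPred_eq, hxB, true_and, not_exists, not_or] at hcon
  apply hx.2
  rw [mem_interior]
  refine ⟨body (pi univ fun i => Ioo 0 (a i)), ?_, ?_, ?_⟩
  · intro y hy
    exact ⟨fun j => (hy j (mem_univ j)).1.le, fun j => (hy j (mem_univ j)).2.le⟩
  · exact (isOpen_set_pi finite_univ fun _ _ => isOpen_Ioo).preimage (PiLp.continuous_ofLp 2 _)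
  · intro j _
    exact ⟨lt_of_le_of_ne (hxB.1 j) (Ne.symm (hcon j).1), lt_of_le_of_ne (hxB.2 j) (hcon j).2⟩

theorem area_box {m : ℕ} {c : ℝ} (hc : ∀ s : Set (Fin m → ℝ), MeasurableSet s →
    μH[(m : ℝ)] (body s) = ENNReal.ofReal c * volume s) (a : Fin (m + 1) → ℝ) :
    μH[(m : ℝ)] (frontier (body (Icc 0 a))) ≤
      ∑ i : Fin (m + 1), 2 * (ENNReal.ofReal c * ∏ j, ENNReal.ofReal (a (i.succAbove j))) := by
  refine (measure_mono (frontier_box a)).trans ((measure_iUnion_fintype_le _ _).trans ?_)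
  refine Finset.sum_le_sum fun i _ => (measure_union_le _ _).trans ?_
  rw [two_mul]
  exact add_le_add (ins_face_le hc a i 0) (ins_face_le hc a i (a i))

theorem area_box' {k : ℕ} {c : ℝ} (hc0 : 0 < c) (hc : ∀ s : Set (Fin (k + 1) → ℝ), MeasurableSet s →
    μH[((k + 1 : ℕ) : ℝ)] (body s) = ENNReal.ofReal c * volume s) (δ b : ℝ) (hδ : 0 < δ) (hb : 0 < b) :
    μH[((k + 1 : ℕ) : ℝ)] (frontier (body (Icc 0 (Fin.cons b fun _ => δ : Fin (k + 2) → ℝ)))) ≤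
      ENNReal.ofReal (2 * c * δ ^ k * (δ + (k + 1) * b)) := by
  refine (area_box hc _).trans (le_of_eq ?_)
  rw [Fin.sum_univ_succ]
  simp only [Fin.prod_univ_succ (n := k), Fin.succ_succAbove_zero, Fin.succ_succAbove_succ,
    Fin.cons_zero, Fin.cons_succ, Fin.zero_succAbove]
  simp only [Finset.prod_const, Finset.sum_const, Finset.card_univ, Fintype.card_fin]
  rw [← ENNReal.ofReal_pow hδ.le, ← ENNReal.ofReal_mul (by positivity), ← ENNReal.ofReal_mul (by positivity),
   ← ENNReal.ofReal_mul (by positivity), ← ENNReal.ofReal_mul (by positivity), nsmul_eq_mul,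
   ← ENNReal.ofReal_ofNat, ← ENNReal.ofReal_natCast, ← ENNReal.ofReal_mul (by positivity), ← ENNReal.ofReal_mul (by positivity),
    ← ENNReal.ofReal_mul (by positivity), ← ENNReal.ofReal_add (by positivity) (by positivity)]
  congr 1
  push_cast
  ring

theorem real_ineq (k : ℕ) (ε c c' δ h : ℝ) (hε0 : 0 < ε) (hε1 : ε < 1) (hc : 0 < c) (hc' : 0 < c')
    (hδ : δ = ε / 2) (hh : h = δ ^ 2 / (k + 1)) :
    (1 - ε) * (k + 2) * (c * (h / (k + 2)) / (2 * c')) <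
    c * (h * (1 - δ) * δ ^ (k + 1)) / (2 * c' * δ ^ k * (δ + (k + 1) * (h * (1 - δ)))) := by
  have hδ0 : 0 < δ := by linarith
  have hδ1 : 0 < 1 - 2 * δ := by linarith
  have hε : ε = 2 * δ := by linarith
  have hkh : (k + 1) * (h * (1 - δ)) = δ ^ 2 * (1 - δ) := by rw [hh]; field_simp
  have hh0 : 0 < h := by rw [hh]; positivity
  have hd : 0 < 1 - δ := by linarith
  rw [hkh, hε]
  have e1 : (1 - 2 * δ) * (k + 2) * (c * (h / (k + 2)) / (2 * c')) = c * h / (2 * c') * (1 - 2 * δ) := by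
    field_simp
  have e2 : c * (h * (1 - δ) * δ ^ (k + 1)) / (2 * c' * δ ^ k * (δ + δ ^ 2 * (1 - δ))) =
      c * h / (2 * c') * ((1 - δ) / (1 + δ * (1 - δ))) := by
    have : 1 + δ * (1 - δ) ≠ 0 := by positivity
    have : δ + δ ^ 2 * (1 - δ) ≠ 0 := by positivity
    field_simp
    ring
  rw [e1, e2]
  apply mul_lt_mul_of_pos_left _ (by positivity)
  rw [lt_div_iff₀ (by positivity)]
  nlinarith [mul_pos hδ0 hδ0, mul_pos hδ0 hd, mul_pos (mul_pos hδ0 hδ0) hd]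

theorem stmt10 (n : ℕ) (hn : 2 ≤ n) (ε : ℝ) (hε0 : 0 < ε) (hε1 : ε < 1) :
    ∃ C : Set (EuclideanSpace ℝ (Fin n)),
      IsCompact C ∧ Convex ℝ C ∧ (interior C).Nonempty ∧
      -- the Cheeger constant of `C` (attained by the Cheeger set of `C`)
      -- is larger than `(1-ε) · n` times the volume-to-surface-area ratio of `C`
      ENNReal.ofReal ((1 - ε) * n) * (μH[(n : ℝ)] C / μH[(n : ℝ) - 1] (frontier C)) <
        ⨆ D : {D : Set (EuclideanSpace ℝ (Fin n)) //
          D ⊆ C ∧ IsClosed D ∧ 0 < μH[(n : ℝ) - 1] (frontier (D : Set (EuclideanSpace ℝ (Fin n))))},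
          μH[(n : ℝ)] (D : Set (EuclideanSpace ℝ (Fin n))) /
            μH[(n : ℝ) - 1] (frontier (D : Set (EuclideanSpace ℝ (Fin n)))) := by
  obtain ⟨k, rfl⟩ : ∃ k, n = k + 2 := ⟨n - 2, by omega⟩
  obtain ⟨c, hc0, hc⟩ := haus_eq (k + 2)
  obtain ⟨c', hc0', hc'⟩ := haus_eq (k + 1)
  have hdim : ((k + 2 : ℕ) : ℝ) - 1 = ((k + 1 : ℕ) : ℝ) := by push_cast; ring
  rw [hdim]
  obtain ⟨δ, hδ⟩ : ∃ δ, δ = ε / 2 := ⟨_, rfl⟩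
  obtain ⟨h, hh⟩ : ∃ h, h = δ ^ 2 / (k + 1 : ℝ) := ⟨_, rfl⟩
  have hδ0 : 0 < δ := by linarith
  have hδ1 : 0 < 1 - δ := by linarith
  have hh0 : 0 < h := by rw [hh]; positivity
  have hb0 : 0 < h * (1 - δ) := by positivity
  have hreal := real_ineq k ε c c' δ h hε0 hε1 hc0 hc0' hδ hh
  have hsubP : Icc 0 (Fin.cons (h * (1 - δ)) fun _ => δ : Fin (k + 2) → ℝ) ⊆ pyr (k + 1) h := by
    intro f hf
    refine ⟨hf.1 0, fun j => ⟨hf.1 _, ?_⟩⟩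
    have h1 := hf.2 0
    have h2 := hf.2 j.succ
    simp only [Fin.cons_zero, Fin.cons_succ] at h1 h2
    have : f 0 / h ≤ 1 - δ := by rw [div_le_iff₀ hh0]; linarith
    linarith
  have hbase : 0 < μH[((k + 1 : ℕ) : ℝ)]
      (frontier (body (Icc 0 (Fin.cons (h * (1 - δ)) fun _ => δ : Fin (k + 2) → ℝ)))) := by
    refine lt_of_lt_of_le ?_ ((base_le hc' (Icc 0 (Fin.cons (h * (1 - δ)) fun _ => δ : Fin (k + 2) → ℝ))
      (fun f hf => hf.1 0) (fun _ => δ) ?_).trans (measure_mono inter_subset_left))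
    · simp only [Finset.prod_const, Finset.card_univ, Fintype.card_fin]
      rw [← ENNReal.ofReal_pow hδ0.le, ← ENNReal.ofReal_mul hc0'.le]
      exact ENNReal.ofReal_pos.2 (by positivity)
    · intro y hy
      refine ⟨fun j => ?_, fun j => ?_⟩
      · refine Fin.cases ?_ (fun j => ?_) j
        · simp
        · simpa using hy.1 j
      · refine Fin.cases ?_ (fun j => ?_) j
        · simpa using hb0.le
        · simpa using hy.2 j
  refine ⟨body (pyr (k + 1) h), ?_, ?_, ?_, ?_⟩
  · refine body_compact (isCompact_Icc.of_isClosed_subset (pyr_closed _ _)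
      (?_ : _ ⊆ Icc 0 (Fin.cons h fun _ => 1 : Fin (k + 2) → ℝ)))
    intro f hf
    refine ⟨fun j => ?_, fun j => ?_⟩
    · refine Fin.cases hf.1 (fun j => (hf.2 j).1) j
    · refine Fin.cases ?_ (fun j => ?_) j
      · have := hf.2 0
        simp only [Fin.cons_zero]
        rw [← div_le_one hh0]
        linarith
      · have := hf.2 j
        have h3 : 0 ≤ f 0 / h := div_nonneg hf.1 hh0.le
        simp only [Fin.cons_succ]
        linarith
  · intro x hx y hy a b ha hb hab
    refine ⟨?_, fun j => ⟨?_, ?_⟩⟩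
    · have := hx.1; have := hy.1
      simp only [WithLp.ofLp_add, WithLp.ofLp_smul, Pi.add_apply, Pi.smul_apply, smul_eq_mul]
      positivity
    · have := (hx.2 j).1; have := (hy.2 j).1
      simp only [WithLp.ofLp_add, WithLp.ofLp_smul, Pi.add_apply, Pi.smul_apply, smul_eq_mul]
      positivity
    · have h1 := mul_le_mul_of_nonneg_left (hx.2 j).2 ha
      have h2 := mul_le_mul_of_nonneg_left (hy.2 j).2 hb
      simp only [WithLp.ofLp_add, WithLp.ofLp_smul, Pi.add_apply, Pi.smul_apply, smul_eq_mul]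
      rw [add_div, mul_div_assoc, mul_div_assoc]
      linarith
  · refine ⟨WithLp.toLp 2 (Fin.cons (h * (1 - δ) / 2) fun _ => δ / 2 : Fin (k + 2) → ℝ), ?_⟩
    rw [mem_interior]
    refine ⟨body (pi univ fun i => Ioo 0 ((Fin.cons (h * (1 - δ)) fun _ => δ : Fin (k + 2) → ℝ) i)), ?_, ?_, ?_⟩
    · intro y hy
      exact hsubP ⟨fun j => (hy j (mem_univ j)).1.le, fun j => (hy j (mem_univ j)).2.le⟩
    · exact (isOpen_set_pi finite_univ fun _ _ => isOpen_Ioo).preimage (PiLp.continuous_ofLp 2 _)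
    · intro j _
      refine Fin.cases ?_ (fun j => ?_) j
      · exact ⟨by simpa using hb0, by simpa using hb0⟩
      · exact ⟨by simpa using hδ0, by simpa using hδ0⟩
  · rw [lt_iSup_iff]
    refine ⟨⟨body (Icc 0 (Fin.cons (h * (1 - δ)) fun _ => δ : Fin (k + 2) → ℝ)),
      fun x hx => hsubP hx, body_closed isClosed_Icc, hbase⟩, ?_⟩
    have hVC : μH[((k + 2 : ℕ) : ℝ)] (body (pyr (k + 1) h)) ≤ ENNReal.ofReal (c * (h / (k + 2))) := by
      rw [ENNReal.ofReal_mul hc0.le]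
      refine (hc _ (pyr_closed _ _).measurableSet).le.trans ?_
      gcongr
      exact pyr_vol k h hh0
    have hAC : ENNReal.ofReal (2 * c') ≤ μH[((k + 1 : ℕ) : ℝ)] (frontier (body (pyr (k + 1) h))) := by
      have hm : MeasurableSet {x : EuclideanSpace ℝ (Fin (k + 2)) | x 0 ≤ 0} :=
        (isClosed_le (by fun_prop) (by fun_prop)).measurableSet
      rw [← measure_inter_add_sdiff _ hm, two_mul, ENNReal.ofReal_add hc0'.le hc0'.le]
      refine add_le_add ?_ (lid_le hc' h hh0)
      have := base_le hc' (pyr (k + 1) h) (fun f hf => hf.1) (fun _ => 1) ?_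
      · simpa using this
      · intro y hy
        refine ⟨by simp, fun j => ⟨by simpa using hy.1 j, by simpa using hy.2 j⟩⟩
    have hVD : μH[((k + 2 : ℕ) : ℝ)] (body (Icc 0 (Fin.cons (h * (1 - δ)) fun _ => δ : Fin (k + 2) → ℝ))) =
        ENNReal.ofReal (c * (h * (1 - δ) * δ ^ (k + 1))) := by
      refine (hc _ measurableSet_Icc).trans ?_
      rw [Real.volume_Icc_pi, Fin.prod_univ_succ, ENNReal.ofReal_mul hc0.le, ENNReal.ofReal_mul hb0.le,
        ENNReal.ofReal_pow hδ0.le]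
      simp
    have hAD := area_box' hc0' hc' δ _ hδ0 hb0
    calc _ ≤ ENNReal.ofReal ((1 - ε) * (k + 2 : ℕ)) *
          (ENNReal.ofReal (c * (h / (k + 2))) / ENNReal.ofReal (2 * c')) := by gcongr
      _ = ENNReal.ofReal ((1 - ε) * (k + 2) * (c * (h / (k + 2)) / (2 * c'))) := by
          rw [← ENNReal.ofReal_div_of_pos (by positivity), ← ENNReal.ofReal_mul]
          · push_cast; rfl
          · have : 0 < 1 - ε := by linarith
            positivity
      _ < _ := (ENNReal.ofReal_lt_ofReal_iff_of_nonneg (by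
          have : 0 < 1 - ε := by linarith
          positivity)).2 hreal
      _ = _ := ENNReal.ofReal_div_of_pos (by positivity)
      _ ≤ _ := by
        dsimp only
        rw [hVD]
        gcongr
end
end
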